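/- arXiv:1609.01930 — 3 statements merged into one kernel-verified Lean document; each statement's English description precedes it below -/
import Mathlib

section
/- (E. Witt) Let k be a field of characteristic ≠ 2, let a, b ∈ k be nonzero, and let K = k_{a,b}. Let c, d ∈ k be nonzero and suppose the quaternion algebra (c,d/K) over K (obtained from (c,d/k) by scalar extension along k → K) splits over K. Then either (c,d/k) splits over k, or (c,d/k) is isomorphic as a k-algebra to (a,b/k). That is, the only quaternion algebras defined over k which split over k_{a,b} are (a,b/k) and the split one. -/
open MvPolynomial

noncomputable section

/-- The defining polynomial `a·x² + b·y² − 1` of the affine conic. -/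
def conicPoly (k : Type*) [Field k] (a b : k) : MvPolynomial (Fin 2) k :=
  C a * X 0 ^ 2 + C b * X 1 ^ 2 - 1

/-- The coordinate ring `k[x,y]/(a·x² + b·y² − 1)` of the affine conic. -/
abbrev ConicRing (k : Type*) [Field k] (a b : k) : Type _ :=
  MvPolynomial (Fin 2) k ⧸ Ideal.span {conicPoly k a b}

/-- `K` (together with the embedding `ι : k →+* K`) is a model of the function field
`k_{a,b}`, i.e. the quotient field of `k[x,y]/(a·x² + b·y² − 1)`. -/
def IsConicFunctionField (k : Type*) [Field k] (a b : k)
    (K : Type*) [Field K] (ι : k →+* K) : Prop :=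
  ∃ f : ConicRing k a b →+* K,
    Function.Injective f ∧
    f.comp (algebraMap k (ConicRing k a b)) = ι ∧
    ∀ z : K, ∃ p q : ConicRing k a b, f q ≠ 0 ∧ z = f p / f q

/-- The subgroup of squares in `Kˣ`. -/
def sqSubgroup (K : Type*) [Field K] : Subgroup Kˣ :=
  MonoidHom.range (powMonoidHom 2 : Kˣ →* Kˣ)

/-- The square class group `Kˣ/Kˣ²`. -/
abbrev SqClass (K : Type*) [Field K] := Kˣ ⧸ sqSubgroup K

/-- The square class of a unit. -/
def sqCl {K : Type*} [Field K] (u : Kˣ) : SqClass K := QuotientGroup.mk u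

/-- `α : Kˣ/Kˣ² → Lˣ/Lˣ²` is a Witt equivalence: it sends `-1` to `-1` and preserves
binary value sets. -/
structure IsWittEquiv {K L : Type*} [Field K] [Field L]
    (α : SqClass K ≃* SqClass L) : Prop where
  map_neg_one : α (sqCl (-1)) = sqCl (-1)
  represents : ∀ (a b c : Kˣ) (a' b' c' : Lˣ),
    α (sqCl a) = sqCl a' → α (sqCl b) = sqCl b' → α (sqCl c) = sqCl c' →
    ((∃ x y : K, (c : K) = (a : K) * x ^ 2 + (b : K) * y ^ 2) ↔
      (∃ x y : L, (c' : L) = (a' : L) * x ^ 2 + (b' : L) * y ^ 2))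

/-- Two fields are Witt equivalent if there is a Witt equivalence between them. -/
def WittEquivalent (K L : Type*) [Field K] [Field L] : Prop :=
  ∃ α : SqClass K ≃* SqClass L, IsWittEquiv α

/-- An ordering of a field `F`. -/
structure IsOrdering {F : Type*} [Field F] (P : Set F) : Prop where
  add_mem : ∀ x ∈ P, ∀ y ∈ P, x + y ∈ P
  mul_mem : ∀ x ∈ P, ∀ y ∈ P, x * y ∈ P
  total : ∀ x : F, x ∈ P ∨ -x ∈ P
  antisymm : ∀ x : F, x ∈ P → -x ∈ P → x = 0

section DiagonalForms

open scoped Polynomial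

variable {k ι : Type*} [Field k] [Fintype ι]

theorem Polynomial.coeff_sum_C_mul_sq (w : ι → k) (P : ι → k[X]) {n : ℕ}
    (hP : ∀ i, (P i).natDegree ≤ n) :
    (∑ i, Polynomial.C (w i) * P i ^ 2).coeff (2 * n) = ∑ i, w i * (P i).coeff n ^ 2 := by
  simp only [Polynomial.finsetSum_coeff, Polynomial.coeff_C_mul]
  refine Finset.sum_congr rfl fun i _ => ?_
  rw [Polynomial.coeff_pow_of_natDegree_le (hP i)]

/-- The values of an anisotropic diagonal form on polynomials have no cancellation in top
degree. -/
theorem Polynomial.natDegree_le_of_natDegree_sum_C_mul_sq_le {w : ι → k}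
    (hw : ∀ x : ι → k, ∑ i, w i * x i ^ 2 = 0 → x = 0) (P : ι → k[X]) {m : ℕ}
    (h : (∑ i, Polynomial.C (w i) * P i ^ 2).natDegree ≤ 2 * m) (i : ι) :
    (P i).natDegree ≤ m := by
  obtain ⟨j, -, hj⟩ := Finset.exists_max_image Finset.univ (fun i => (P i).natDegree)
    ⟨i, Finset.mem_univ i⟩
  by_contra! hi
  have hlt : m < (P j).natDegree := hi.trans_le (hj i (Finset.mem_univ i))
  have hcoeff := Polynomial.coeff_sum_C_mul_sq w P fun i => hj i (Finset.mem_univ i)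
  rw [Polynomial.coeff_eq_zero_of_natDegree_lt (by omega)] at hcoeff
  have h0 : (P j).leadingCoeff = 0 := congrFun (hw _ hcoeff.symm) j
  rw [Polynomial.leadingCoeff_eq_zero] at h0
  simp [h0] at hlt

theorem Polynomial.eq_zero_of_sum_C_mul_sq_eq_zero {w : ι → k}
    (hw : ∀ x : ι → k, ∑ i, w i * x i ^ 2 = 0 → x = 0) (P : ι → k[X])
    (h : ∑ i, Polynomial.C (w i) * P i ^ 2 = 0) : P = 0 := by
  have hdeg : ∀ i, (P i).natDegree ≤ 0 :=
    Polynomial.natDegree_le_of_natDegree_sum_C_mul_sq_le hw P (by simp [h])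
  have hcoeff := Polynomial.coeff_sum_C_mul_sq w P hdeg
  rw [h, Polynomial.coeff_zero] at hcoeff
  have h0 := hw _ hcoeff.symm
  funext i
  rw [Polynomial.eq_C_of_natDegree_le_zero (hdeg i), congrFun h0 i]
  simp

theorem sum_mul_add_sq {R : Type*} [CommRing R] (w P U : ι → R) (s t : R) :
    ∑ i, w i * (s * P i + t * U i) ^ 2 =
      s ^ 2 * ∑ i, w i * P i ^ 2 + 2 * s * t * ∑ i, w i * (P i * U i) +
        t ^ 2 * ∑ i, w i * U i ^ 2 := by
  simp only [Finset.mul_sum, ← Finset.sum_add_distrib]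
  exact Finset.sum_congr rfl fun i _ => by ring

/-- The **Cassels–Pfister theorem** for an anisotropic diagonal form. -/
theorem Polynomial.exists_sum_C_mul_sq_eq {w : ι → k}
    (hw : ∀ x : ι → k, ∑ i, w i * x i ^ 2 = 0 → x = 0) (F g : k[X]) (hg : g ≠ 0)
    (P : ι → k[X]) (h : ∑ i, Polynomial.C (w i) * P i ^ 2 = g ^ 2 * F) :
    ∃ U : ι → k[X], ∑ i, Polynomial.C (w i) * U i ^ 2 = F := by
  induction hn : g.natDegree using Nat.strong_induction_on generalizing g P with
  | _ n ih =>
  set U : ι → k[X] := fun i => P i / g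
  set R : ι → k[X] := fun i => P i % g
  have hdiv : ∀ i, R i = 1 * P i + (-g) * U i := fun i => by
    linear_combination (EuclideanDomain.div_add_mod (P i) g)
  by_cases hR0 : R = 0
  · refine ⟨U, mul_left_cancel₀ (pow_ne_zero 2 hg) ?_⟩
    rw [← h, Finset.mul_sum]
    refine Finset.sum_congr rfl fun i _ => ?_
    have hi : P i = g * U i := by
      have hRi : R i = 0 := congrFun hR0 i
      linear_combination hRi - hdiv i
    rw [hi]
    ring
  · have hφR : ∑ i, Polynomial.C (w i) * R i ^ 2 ≠ 0 := fun h0 =>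
      hR0 (Polynomial.eq_zero_of_sum_C_mul_sq_eq_zero hw R h0)
    set S := ∑ i, Polynomial.C (w i) * U i ^ 2 with hS
    set T := ∑ i, Polynomial.C (w i) * (P i * U i) with hT
    have hexp : ∑ i, Polynomial.C (w i) * R i ^ 2 =
        g * ((S - F) * g + 2 * (F * g - T)) := by
      simp only [hdiv]
      rw [sum_mul_add_sq, h, ← hS, ← hT]
      ring
    have hg' : (S - F) * g + 2 * (F * g - T) ≠ 0 := fun h0 => hφR (by rw [hexp, h0, mul_zero])
    have hlt : ∀ i, R i ≠ 0 → (R i).natDegree < n := fun i hi =>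
      hn ▸ Polynomial.natDegree_lt_natDegree hi (Polynomial.degree_mod_lt (P i) hg)
    obtain ⟨i, hi⟩ := Function.ne_iff.1 hR0
    have hn0 : 0 < n := (Nat.zero_le _).trans_lt (hlt i hi)
    have hRdeg : ∀ i, (R i).natDegree ≤ n - 1 := fun i => by
      by_cases hi : R i = 0
      · simp [hi]
      · have := hlt i hi
        omega
    have hdeg : (∑ i, Polynomial.C (w i) * R i ^ 2).natDegree ≤ 2 * (n - 1) :=
      Polynomial.natDegree_sum_le_of_forall_le _ _ fun i _ =>
        (Polynomial.natDegree_C_mul_le _ _).trans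
          (Polynomial.natDegree_pow_le.trans (Nat.mul_le_mul_left 2 (hRdeg i)))
    rw [hexp, Polynomial.natDegree_mul hg hg', hn] at hdeg
    refine ih _ (by omega) _ hg' (fun i => (S - F) * P i + 2 * (F * g - T) * U i) ?_ rfl
    rw [sum_mul_add_sq, h, ← hS, ← hT]
    ring

end DiagonalForms

section QuaternionAlgebras

open scoped Quaternion

variable {k R S : Type*} [Field k] [CommRing R] [CommRing S]

/-- The norm form of the quaternion algebra `ℍ[R, c, d]` has weights `1, -c, -d, c * d`. -/
def quaternionNormWeights (c d : R) : Fin 4 → R := ![1, -c, -d, c * d]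

/-- The weights of the form `q ↦ q²` on pure quaternions in `ℍ[R, c, d]`. -/
def quaternionPureWeights (c d : R) : Fin 3 → R := ![c, d, -(c * d)]

theorem map_quaternionNormWeights (f : R →+* S) (c d : R) (i : Fin 4) :
    f (quaternionNormWeights c d i) = quaternionNormWeights (f c) (f d) i := by
  fin_cases i <;> simp [quaternionNormWeights]

theorem map_quaternionPureWeights (f : R →+* S) (c d : R) (i : Fin 3) :
    f (quaternionPureWeights c d i) = quaternionPureWeights (f c) (f d) i := by
  fin_cases i <;> simp [quaternionPureWeights]

theorem quaternionPureWeights_anisotropic {c d : k}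
    (h : ∀ x : Fin 4 → k, ∑ i, quaternionNormWeights c d i * x i ^ 2 = 0 → x = 0)
    (x : Fin 3 → k) (hx : ∑ i, quaternionPureWeights c d i * x i ^ 2 = 0) : x = 0 := by
  have h0 := h ![0, x 0, x 1, x 2] (by
    simp [Fin.sum_univ_succ, quaternionNormWeights, quaternionPureWeights] at hx ⊢
    linear_combination -hx)
  funext i
  fin_cases i
  · exact congrFun h0 1
  · exact congrFun h0 2
  · exact congrFun h0 3

theorem QuaternionAlgebra.Basis.liftHom_injective {A : Type*} [Ring A] [Algebra k A]
    [Nontrivial A] (h2 : (2 : k) ≠ 0) {c d : k} (hc : c ≠ 0) (hd : d ≠ 0)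
    (q : QuaternionAlgebra.Basis A c 0 d) : Function.Injective q.liftHom := by
  rw [injective_iff_map_eq_zero]
  have key : ∀ x : ℍ[k, c, d], q.liftHom x = 0 → x.re = 0 := fun x hx => by
    set I : ℍ[k, c, d] := ⟨0, 1, 0, 0⟩
    set J : ℍ[k, c, d] := ⟨0, 0, 1, 0⟩
    set y : ℍ[k, c, d] := c • x + I * x * I with hy
    have hy0 : q.liftHom y = 0 := by simp only [hy, map_add, map_mul, map_smul, hx]; simp
    have hz0 : q.liftHom (d • y + J * y * J) = 0 := by
      simp only [map_add, map_mul, map_smul, hy0]; simp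
    have hz : d • y + J * y * J = algebraMap k _ (4 * c * d * x.re) := by
      ext <;> simp [hy, I, J] <;> ring
    rw [hz, AlgHom.commutes, map_eq_zero_iff _ (algebraMap k A).injective] at hz0
    have h4 : (4 : k) ≠ 0 := by
      rw [show (4 : k) = 2 * 2 by norm_num]
      exact mul_ne_zero h2 h2
    simpa [hc, hd, h4] using hz0
  intro x hx
  have hmul : ∀ y : ℍ[k, c, d], (x * y).re = 0 := fun y => key _ (by rw [map_mul, hx, zero_mul])
  have h1 := hmul 1
  have hI := hmul ⟨0, 1, 0, 0⟩
  have hJ := hmul ⟨0, 0, 1, 0⟩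
  have hK := hmul ⟨0, 0, 0, 1⟩
  simp [hc, hd] at h1 hI hJ hK
  ext <;> simp [*]

/-- Anticommuting elements with squares `b ≠ 0` and `-(a * b)` generate a copy of
`ℍ[k, a, b]`. -/
def QuaternionAlgebra.Basis.ofAnticomm {A : Type*} [Ring A] [Algebra k A] {a b : k} (hb : b ≠ 0)
    (u v : A) (hu : u * u = b • (1 : A)) (hv : v * v = -(a * b) • (1 : A))
    (huv : u * v = -(v * u)) : QuaternionAlgebra.Basis A a 0 b where
  i := b⁻¹ • (v * u)
  j := u
  k := v
  i_mul_i := by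
    have h : v * u * (v * u) = (a * b * b) • (1 : A) := by
      rw [mul_assoc, ← mul_assoc u, huv, neg_mul, mul_neg, mul_assoc v u u, hu, mul_smul_comm,
        mul_one, mul_smul_comm, hv, smul_smul, ← neg_smul]
      congr 1
      ring
    rw [smul_mul_smul_comm, h, smul_smul, zero_smul, add_zero]
    congr 1
    field_simp
  j_mul_j := hu
  i_mul_j := by
    rw [smul_mul_assoc, mul_assoc, hu, mul_smul_comm, mul_one, smul_smul, inv_mul_cancel₀ hb,
      one_smul]
  j_mul_i := by
    rw [mul_smul_comm, ← mul_assoc, huv, neg_mul, mul_assoc, hu, mul_smul_comm, mul_one,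
      smul_neg, smul_smul, inv_mul_cancel₀ hb, one_smul, zero_smul, zero_sub]

theorem QuaternionAlgebra.Basis.nonempty_algEquiv {A : Type*} [Ring A] [Algebra k A]
    [Nontrivial A] (hA : Module.finrank k A = 4) (h2 : (2 : k) ≠ 0) {c d : k}
    (hc : c ≠ 0) (hd : d ≠ 0) (q : QuaternionAlgebra.Basis A c 0 d) :
    Nonempty (ℍ[k, c, d] ≃ₐ[k] A) := by
  have : FiniteDimensional k A := Module.finite_of_finrank_pos (by omega)
  have hinj := q.liftHom_injective h2 hc hd
  refine ⟨AlgEquiv.ofBijective q.liftHom ⟨hinj, ?_⟩⟩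
  exact (LinearMap.injective_iff_surjective_of_finrank_eq_finrank
    (f := q.liftHom.toLinearMap) (by rw [QuaternionAlgebra.finrank_eq_four, hA])).1 hinj

theorem QuaternionAlgebra.nonempty_algEquiv_matrix_of_isotropic (h2 : (2 : k) ≠ 0) {c d : k}
    (hc : c ≠ 0) (hd : d ≠ 0)
    (h : ∃ x : Fin 4 → k, ∑ i, quaternionNormWeights c d i * x i ^ 2 = 0 ∧ x ≠ 0) :
    Nonempty (ℍ[k, c, d] ≃ₐ[k] Matrix (Fin 2) (Fin 2) k) := by
  suffices Nonempty (QuaternionAlgebra.Basis (Matrix (Fin 2) (Fin 2) k) c 0 d) from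
    this.elim fun q => q.nonempty_algEquiv (by simp [Module.finrank_matrix]) h2 hc hd
  by_cases hs : ∃ s, c = s ^ 2
  · obtain ⟨s, rfl⟩ := hs
    refine ⟨⟨!![s, 0; 0, -s], !![0, d; 1, 0], !![0, s * d; -s, 0], ?_, ?_, ?_, ?_⟩⟩ <;>
      ext i j <;> fin_cases i <;> fin_cases j <;> simp [sq, mul_comm]
  · obtain ⟨x, hx, hx0⟩ := h
    have hns : ∀ u v : k, u ^ 2 = c * v ^ 2 → u = 0 ∧ v = 0 := fun u v huv => by
      by_cases hv : v = 0
      · simpa [hv] using huv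
      · exact (hs ⟨u / v, by field_simp; exact huv.symm⟩).elim
    simp [Fin.sum_univ_succ, quaternionNormWeights] at hx
    set e := x 2 ^ 2 - c * x 3 ^ 2 with he
    have he0 : e ≠ 0 := fun h0 => hx0 <| by
      obtain ⟨h2, h3⟩ := hns (x 2) (x 3) (by linear_combination h0)
      obtain ⟨h0, h1⟩ := hns (x 0) (x 1) (by
        simp [h2, h3] at hx
        linear_combination hx)
      funext i
      fin_cases i <;> assumption
    obtain ⟨α, β, hd'⟩ : ∃ α β : k, α * α - c * (β * β) = d := by
      refine ⟨(x 0 * x 2 - c * x 1 * x 3) / e, (x 1 * x 2 - x 0 * x 3) / e, ?_⟩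
      field_simp
      rw [he]
      linear_combination (x 2 ^ 2 - c * x 3 ^ 2) * hx
    refine ⟨⟨!![0, c; 1, 0], !![α, -(c * β); β, -α], !![c * β, -(c * α); α, -(c * β)],
      ?_, ?_, ?_, ?_⟩⟩ <;> ext i j <;> fin_cases i <;> fin_cases j <;> 
      simp <;> first | ring1 | linear_combination hd'

/-- A split quaternion algebra has an isotropic norm form. -/
theorem QuaternionAlgebra.isotropic_of_nonempty_algEquiv_matrix {c d : k}
    (h : Nonempty (ℍ[k, c, d] ≃ₐ[k] Matrix (Fin 2) (Fin 2) k)) :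
    ∃ x : Fin 4 → k, ∑ i, quaternionNormWeights c d i * x i ^ 2 = 0 ∧ x ≠ 0 := by
  obtain ⟨e⟩ := h
  set q := e.symm !![0, 1; 0, 0] with hq
  have hqq : q * q = 0 := by
    rw [hq, ← map_mul, ← map_zero e.symm]
    congr 1
    ext i j
    fin_cases i <;> fin_cases j <;> simp
  have hq0 : q ≠ 0 := fun h0 => by
    have := congrFun (congrFun ((map_eq_zero_iff _ e.symm.injective).1 h0) 0) 1
    simp at this
  refine ⟨![q.re, q.imI, q.imJ, q.imK], ?_, fun h0 => hq0 ?_⟩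
  · set N := ∑ i, quaternionNormWeights c d i * ![q.re, q.imI, q.imJ, q.imK] i ^ 2 with hN
    simp [Fin.sum_univ_succ, quaternionNormWeights] at hN
    have hstar : star q * q = algebraMap k _ N := by
      rw [QuaternionAlgebra.algebraMap_eq]
      ext <;> simp <;> first | ring1 | linear_combination -hN
    have hNq : N • q = 0 := by
      rw [Algebra.smul_def, ← hstar, mul_assoc, hqq, mul_zero]
    exact (smul_eq_zero.1 hNq).resolve_right hq0
  · ext
    · exact congrFun h0 0
    · exact congrFun h0 1
    · exact congrFun h0 2
    · exact congrFun h0 3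

/-- The pure part of the quaternion `A * star B`, as a triple of coordinates. -/
def quaternionMulStarIm (c d : R) (A B : Fin 4 → R) : Fin 3 → R :=
  ![A 1 * B 0 - A 0 * B 1 + d * (A 2 * B 3 - A 3 * B 2),
    A 2 * B 0 - A 0 * B 2 + c * (A 3 * B 1 - A 1 * B 3),
    A 3 * B 0 - A 0 * B 3 + A 2 * B 1 - A 1 * B 2]

theorem sum_quaternionPureWeights_mul_mulStarIm_sq (c d : R) (A B : Fin 4 → R) :
    ∑ i, quaternionPureWeights c d i * quaternionMulStarIm c d A B i ^ 2 =
      (∑ i, quaternionNormWeights c d i * (A i * B i)) ^ 2 -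
        (∑ i, quaternionNormWeights c d i * A i ^ 2) *
          ∑ i, quaternionNormWeights c d i * B i ^ 2 := by
  simp [Fin.sum_univ_succ, quaternionNormWeights, quaternionPureWeights, quaternionMulStarIm]
  ring

end QuaternionAlgebras

section ConicRing

open scoped Polynomial

variable {k : Type*} [Field k] {a b : k}

/-- The coordinate functions on the conic. -/
def ConicRing.coord (a b : k) (i : Fin 2) : ConicRing k a b :=
  Ideal.Quotient.mk _ (MvPolynomial.X i)

theorem ConicRing.coord_one_sq (hb : b ≠ 0) :
    ConicRing.coord a b 1 ^ 2 = Polynomial.aeval (ConicRing.coord a b 0)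
      (Polynomial.C b⁻¹ * (1 - Polynomial.C a * Polynomial.X ^ 2)) := by
  have h : Ideal.Quotient.mk (Ideal.span {conicPoly k a b})
      (MvPolynomial.C a * MvPolynomial.X 0 ^ 2 + MvPolynomial.C b * MvPolynomial.X 1 ^ 2 - 1) = 0 :=
    Ideal.Quotient.eq_zero_iff_mem.2 (Ideal.mem_span_singleton_self _)
  have hC : ∀ r : k, Ideal.Quotient.mk (Ideal.span {conicPoly k a b}) (MvPolynomial.C r) =
      algebraMap k (ConicRing k a b) r := fun r => rfl
  simp only [map_sub, map_add, map_mul, map_pow, map_one, hC] at h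
  have hb' : algebraMap k (ConicRing k a b) b⁻¹ * algebraMap k (ConicRing k a b) b = 1 := by
    rw [← map_mul, inv_mul_cancel₀ hb, map_one]
  simp only [ConicRing.coord, map_sub, map_mul, map_pow, map_one, Polynomial.aeval_C,
    Polynomial.aeval_X]
  linear_combination (algebraMap k (ConicRing k a b) b⁻¹) * h -
    (Ideal.Quotient.mk (Ideal.span {conicPoly k a b}) (MvPolynomial.X 1)) ^ 2 * hb'

theorem ConicRing.exists_eq_aeval_add (hb : b ≠ 0) (r : ConicRing k a b) :
    ∃ A B : k[X], r = Polynomial.aeval (ConicRing.coord a b 0) A +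
      Polynomial.aeval (ConicRing.coord a b 0) B * ConicRing.coord a b 1 := by
  obtain ⟨p, rfl⟩ := Ideal.Quotient.mk_surjective r
  induction p using MvPolynomial.induction_on with
  | C r => exact ⟨Polynomial.C r, 0, by simp; rfl⟩
  | add p q hp hq =>
    obtain ⟨A, B, h⟩ := hp
    obtain ⟨A', B', h'⟩ := hq
    exact ⟨A + A', B + B', by rw [map_add, h, h', map_add, map_add]; ring⟩
  | mul_X p i hp =>
    obtain ⟨A, B, h⟩ := hp
    rw [map_mul, h]
    fin_cases i
    · refine ⟨A * Polynomial.X, B * Polynomial.X, ?_⟩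
      rw [map_mul, map_mul, Polynomial.aeval_X]
      simp only [ConicRing.coord, Fin.zero_eta]
      ring
    · refine ⟨B * (Polynomial.C b⁻¹ * (1 - Polynomial.C a * Polynomial.X ^ 2)), A, ?_⟩
      rw [map_mul, ← ConicRing.coord_one_sq hb]
      simp only [ConicRing.coord, Fin.mk_one]
      ring

theorem ConicRing.eq_zero_of_aeval_add_eq_zero (hb : b ≠ 0) {A B : k[X]}
    (h : Polynomial.aeval (ConicRing.coord a b 0) A +
      Polynomial.aeval (ConicRing.coord a b 0) B * ConicRing.coord a b 1 = 0) :
    A = 0 ∧ B = 0 := by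
  let S := QuadraticAlgebra k[X] (Polynomial.C b⁻¹ * (1 - Polynomial.C a * Polynomial.X ^ 2)) 0
  let v : Fin 2 → S := ![algebraMap k[X] S Polynomial.X, QuadraticAlgebra.omega]
  let φ : ConicRing k a b →ₐ[k] S := Ideal.Quotient.liftₐ _ (MvPolynomial.aeval v) <| by
    intro p hp
    obtain ⟨q, rfl⟩ := Ideal.mem_span_singleton.1 hp
    have hC : ∀ r : k, algebraMap k S r = algebraMap k[X] S (Polynomial.C r) := fun r => rfl
    have h0 : MvPolynomial.aeval v (conicPoly k a b) = 0 := by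
      have hω : (QuadraticAlgebra.omega : S) ^ 2 = algebraMap k[X] S
          (Polynomial.C b⁻¹ * (1 - Polynomial.C a * Polynomial.X ^ 2)) := by
        rw [sq, QuadraticAlgebra.omega_mul_omega_eq_mk]
        rfl
      have hbb : (Polynomial.C b * Polynomial.C b⁻¹ : k[X]) = 1 := by
        rw [← Polynomial.C_mul, mul_inv_cancel₀ hb, Polynomial.C_1]
      simp only [conicPoly, map_sub, map_add, map_mul, map_pow, map_one, MvPolynomial.aeval_X,
        MvPolynomial.aeval_C, v, Matrix.cons_val_zero, Matrix.cons_val_one, hω, hC]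
      simp only [← map_mul, ← map_pow, ← map_add, ← map_sub, ← map_one (algebraMap k[X] S)]
      rw [← map_zero (algebraMap k[X] S)]
      congr 1
      linear_combination (1 - Polynomial.C a * Polynomial.X ^ 2) * hbb
    rw [map_mul, h0, zero_mul]
  have hφ : ∀ i, φ (ConicRing.coord a b i) = v i := fun i => by
    change MvPolynomial.aeval v (MvPolynomial.X i) = v i
    simp
  have hA : ∀ A : k[X], φ (Polynomial.aeval (ConicRing.coord a b 0) A) = algebraMap k[X] S A :=
    fun A => by
      rw [← Polynomial.aeval_algHom_apply, hφ]
      simp [v, Polynomial.aeval_algebraMap_apply]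
  have h' := congrArg φ h
  rw [map_add, map_mul, hA, hA, hφ, map_zero] at h'
  constructor
  · simpa [v, S] using congrArg QuadraticAlgebra.re h'
  · simpa [v, S] using congrArg QuadraticAlgebra.im h'

/-- A diagonal form over `k` that is isotropic over the function field of the conic has an
isotropic vector over the coordinate ring. -/
theorem IsConicFunctionField.exists_isotropic {K : Type*} [Field K] {ι : k →+* K}
    (hK : IsConicFunctionField k a b K ι) {n : ℕ} (w : Fin n → k)
    (h : ∃ x : Fin n → K, ∑ i, ι (w i) * x i ^ 2 = 0 ∧ x ≠ 0) :
    ∃ x : Fin n → ConicRing k a b, ∑ i, algebraMap k _ (w i) * x i ^ 2 = 0 ∧ x ≠ 0 := by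
  obtain ⟨f, hf, rfl, hfrac⟩ := hK
  obtain ⟨x, hx, hx0⟩ := h
  choose p q hq hpq using fun i => hfrac (x i)
  have hy : ∀ i, f (p i * ∏ j ∈ Finset.univ.erase i, q j) = x i * f (∏ j, q j) := fun i => by
    rw [← Finset.mul_prod_erase _ q (Finset.mem_univ i), hpq i, map_mul, map_mul]
    have := hq i
    field_simp
  refine ⟨fun i => p i * ∏ j ∈ Finset.univ.erase i, q j, hf ?_, fun h0 => hx0 ?_⟩
  · rw [map_zero, map_sum]
    refine Eq.trans ?_ (mul_eq_zero_of_left hx (f (∏ j, q j) ^ 2))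
    rw [Finset.sum_mul]
    refine Finset.sum_congr rfl fun i _ => ?_
    rw [map_mul, map_pow, hy, mul_pow, ← mul_assoc, RingHom.comp_apply]
  · funext i
    have hi := hy i
    rw [show p i * ∏ j ∈ Finset.univ.erase i, q j = 0 from congrFun h0 i, map_zero] at hi
    refine (mul_eq_zero.1 hi.symm).resolve_right ?_
    rw [map_prod]
    exact Finset.prod_ne_zero_iff.2 fun j _ => hq j

/-- An isotropic vector over the coordinate ring of the conic, written in terms of
polynomials. -/
theorem ConicRing.exists_polynomial_isotropic (h2 : (2 : k) ≠ 0) (hb : b ≠ 0) {n : ℕ}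
    (w : Fin n → k)
    (h : ∃ x : Fin n → ConicRing k a b, ∑ i, algebraMap k _ (w i) * x i ^ 2 = 0 ∧ x ≠ 0) :
    ∃ A B : Fin n → k[X], (A ≠ 0 ∨ B ≠ 0) ∧
      ∑ i, Polynomial.C (w i) * (A i * B i) = 0 ∧
      ∑ i, Polynomial.C (w i) * A i ^ 2 +
        Polynomial.C b⁻¹ * (1 - Polynomial.C a * Polynomial.X ^ 2) *
          ∑ i, Polynomial.C (w i) * B i ^ 2 = 0 := by
  obtain ⟨x, hx, hx0⟩ := h
  choose A B hAB using fun i => ConicRing.exists_eq_aeval_add hb (x i)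
  have hsum : Polynomial.aeval (ConicRing.coord a b 0) (∑ i, Polynomial.C (w i) * A i ^ 2 +
        Polynomial.C b⁻¹ * (1 - Polynomial.C a * Polynomial.X ^ 2) *
          ∑ i, Polynomial.C (w i) * B i ^ 2) +
      Polynomial.aeval (ConicRing.coord a b 0) (2 * ∑ i, Polynomial.C (w i) * (A i * B i)) *
        ConicRing.coord a b 1 = 0 := by
    have hexp := sum_mul_add_sq (fun i => algebraMap k (ConicRing k a b) (w i))
      (fun i => Polynomial.aeval (ConicRing.coord a b 0) (A i))
      (fun i => Polynomial.aeval (ConicRing.coord a b 0) (B i)) 1 (ConicRing.coord a b 1)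
    rw [ConicRing.coord_one_sq hb] at hexp
    have hx' : ∑ i, algebraMap k (ConicRing k a b) (w i) *
        (1 * Polynomial.aeval (ConicRing.coord a b 0) (A i) +
          ConicRing.coord a b 1 * Polynomial.aeval (ConicRing.coord a b 0) (B i)) ^ 2 = 0 := by
      rw [← hx]
      exact Finset.sum_congr rfl fun i _ => by rw [hAB i]; ring
    rw [hx'] at hexp
    simp only [map_add, map_mul, map_sum, map_pow, Polynomial.aeval_C, map_ofNat] at hexp ⊢
    linear_combination -hexp
  obtain ⟨h1, h2'⟩ := ConicRing.eq_zero_of_aeval_add_eq_zero hb hsum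
  refine ⟨A, B, ?_, ?_, h1⟩
  · by_contra! h0
    exact hx0 (funext fun i => by rw [hAB i, h0.1, h0.2]; simp)
  · refine (mul_eq_zero.1 h2').resolve_left ?_
    rw [← Polynomial.C_ofNat, Polynomial.C_eq_zero]
    exact h2

end ConicRing

open Quaternion in
/-- (E. Witt) Let `k` be a field of characteristic `≠ 2`, `a, b ∈ k` nonzero, and let `K`
be the function field `k_{a,b}`.  If the quaternion algebra `(c,d/K)` (obtained from
`(c,d/k)` by scalar extension along `ι : k → K`) splits over `K`, then `(c,d/k)` splits
over `k` or `(c,d/k) ≅ (a,b/k)` as `k`-algebras. -/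
theorem quaternionAlgebra_split_over_conicFunctionField
    (k : Type*) [Field k] (hchar : (2 : k) ≠ 0)
    (a b : k) (ha : a ≠ 0) (hb : b ≠ 0)
    (K : Type*) [Field K] (ι : k →+* K)
    (hK : IsConicFunctionField k a b K ι)
    (c d : k) (hc : c ≠ 0) (hd : d ≠ 0)
    (hsplit : Nonempty (ℍ[K, ι c, ι d] ≃ₐ[K] Matrix (Fin 2) (Fin 2) K)) :
    Nonempty (ℍ[k, c, d] ≃ₐ[k] Matrix (Fin 2) (Fin 2) k) ∨
      Nonempty (ℍ[k, c, d] ≃ₐ[k] ℍ[k, a, b]) := by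
  refine or_iff_not_imp_left.2 fun hns => ?_
  have hN : ∀ x : Fin 4 → k, ∑ i, quaternionNormWeights c d i * x i ^ 2 = 0 → x = 0 := by
    intro x hx
    by_contra hx0
    exact hns (QuaternionAlgebra.nonempty_algEquiv_matrix_of_isotropic hchar hc hd ⟨x, hx, hx0⟩)
  have hpure := quaternionPureWeights_anisotropic hN
  have hiso := QuaternionAlgebra.isotropic_of_nonempty_algEquiv_matrix hsplit
  simp only [← map_quaternionNormWeights] at hiso
  obtain ⟨A, B, hAB0, hAB, hsum⟩ :=
    ConicRing.exists_polynomial_isotropic hchar hb _ (hK.exists_isotropic _ hiso)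
  have hB : B ≠ 0 := by
    rintro rfl
    refine hAB0.elim (fun h => h ?_) fun h => h rfl
    exact Polynomial.eq_zero_of_sum_C_mul_sq_eq_zero hN A (by simpa using hsum)
  have hNB : ∑ i, Polynomial.C (quaternionNormWeights c d i) * B i ^ 2 ≠ 0 := fun h =>
    hB (Polynomial.eq_zero_of_sum_C_mul_sq_eq_zero hN B h)
  have hbb : (Polynomial.C b * Polynomial.C b⁻¹ : Polynomial k) = 1 := by
    rw [← Polynomial.C_mul, mul_inv_cancel₀ hb, Polynomial.C_1]
  obtain ⟨U, hU⟩ := Polynomial.exists_sum_C_mul_sq_eq hpure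
    (Polynomial.C b * (1 - Polynomial.C a * Polynomial.X ^ 2))
    (Polynomial.C b⁻¹ * ∑ i, Polynomial.C (quaternionNormWeights c d i) * B i ^ 2)
    (mul_ne_zero (Polynomial.C_ne_zero.2 (inv_ne_zero hb)) hNB)
    (quaternionMulStarIm (Polynomial.C c) (Polynomial.C d) A B) (by
      simp only [map_quaternionNormWeights, map_quaternionPureWeights] at hAB hsum ⊢
      rw [sum_quaternionPureWeights_mul_mulStarIm_sq]
      set N := ∑ i, quaternionNormWeights (Polynomial.C c) (Polynomial.C d) i * B i ^ 2
      set T := ∑ i, quaternionNormWeights (Polynomial.C c) (Polynomial.C d) i * (A i * B i)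
      linear_combination T * hAB - N * hsum - N ^ 2 * Polynomial.C b⁻¹ *
        (1 - Polynomial.C a * Polynomial.X ^ 2) * hbb)
  have hdeg : ∀ i, (U i).natDegree ≤ 1 :=
    Polynomial.natDegree_le_of_natDegree_sum_C_mul_sq_le hpure U (by
      rw [hU]
      compute_degree)
  obtain ⟨u, v, huv⟩ : ∃ u v : Fin 3 → k, ∀ i,
      U i = Polynomial.C (v i) * Polynomial.X + Polynomial.C (u i) :=
    ⟨fun i => (U i).coeff 0, fun i => (U i).coeff 1, fun i =>
      Polynomial.eq_X_add_C_of_natDegree_le_one (hdeg i)⟩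
  have hpoly : Polynomial.C (∑ i, quaternionPureWeights c d i * v i ^ 2) * Polynomial.X ^ 2 +
      Polynomial.C (2 * ∑ i, quaternionPureWeights c d i * (u i * v i)) * Polynomial.X +
      Polynomial.C (∑ i, quaternionPureWeights c d i * u i ^ 2) =
      Polynomial.C (-(a * b)) * Polynomial.X ^ 2 + Polynomial.C 0 * Polynomial.X +
        Polynomial.C b := by
    simp only [huv] at hU
    have hexp := sum_mul_add_sq (fun i => Polynomial.C (quaternionPureWeights c d i))
      (fun i => Polynomial.C (u i)) (fun i => Polynomial.C (v i)) 1 Polynomial.X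
    have hcomm : ∑ i, Polynomial.C (quaternionPureWeights c d i) *
        (1 * Polynomial.C (u i) + Polynomial.X * Polynomial.C (v i)) ^ 2 =
        Polynomial.C b * (1 - Polynomial.C a * Polynomial.X ^ 2) := by
      rw [← hU]
      exact Finset.sum_congr rfl fun i _ => by ring
    rw [hcomm] at hexp
    simp only [map_sum, map_mul, map_pow, map_neg, map_zero, map_ofNat] at hexp ⊢
    linear_combination -hexp
  have h0 := congrArg (fun p => Polynomial.coeff p 0) hpoly
  have h1 := congrArg (fun p => Polynomial.coeff p 1) hpoly
  have h2 := congrArg (fun p => Polynomial.coeff p 2) hpoly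
  simp [Polynomial.coeff_X, Polynomial.coeff_C, hchar, -map_sum, -map_mul] at h0 h1 h2
  simp [Fin.sum_univ_succ, quaternionPureWeights] at h0 h1 h2
  let x : ℍ[k, c, d] := ⟨0, u 0, u 1, u 2⟩
  let y : ℍ[k, c, d] := ⟨0, v 0, v 1, v 2⟩
  have hxx : x * x = b • (1 : ℍ[k, c, d]) := by
    ext <;> simp [x] <;> first | ring1 | linear_combination h0
  have hyy : y * y = -(a * b) • (1 : ℍ[k, c, d]) := by
    ext <;> simp [y] <;> first | ring1 | linear_combination h2
  have hxy : x * y = -(y * x) := by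
    ext <;> simp [x, y] <;> first | ring1 | linear_combination 2 * h1
  exact ((QuaternionAlgebra.Basis.ofAnticomm hb x y hxx hyy hxy).nonempty_algEquiv
    (QuaternionAlgebra.finrank_eq_four _ _ _) hchar ha hb).map AlgEquiv.symm

end
end

section
/- (E. Witt) Let k be a field of characteristic ≠ 2 and let a, b, c, d ∈ k be nonzero. Then the quaternion algebras (a,b/k) and (c,d/k) are isomorphic as k-algebras if and only if the fields k_{a,b} and k_{c,d} are isomorphic as k-algebras (i.e., k-isomorphic as field extensions of k). -/
open MvPolynomial

noncomputable section

/-- The quadratic form `c·u² + d·v² − cd·w²` of squares of pure quaternions. -/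
def pureNorm {R : Type*} [CommRing R] (c d u v w : R) : R :=
  c * u ^ 2 + d * v ^ 2 - c * d * w ^ 2

/-- The pure quaternion form of `(c,d/k)` has no nontrivial zero. -/
def PureAnisotropic {R : Type*} [CommRing R] (c d : R) : Prop :=
  ∀ u v w : R, pureNorm c d u v w = 0 → u = 0 ∧ v = 0 ∧ w = 0

section PolynomialForms

open Polynomial

variable {k : Type*} [Field k] {c d : k}

lemma natDegree_pureNorm_le (p q r : k[X]) {n : ℕ} (hp : p.natDegree ≤ n)
    (hq : q.natDegree ≤ n) (hr : r.natDegree ≤ n) :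
    (pureNorm (Polynomial.C c) (Polynomial.C d) p q r).natDegree ≤ 2 * n := by
  have aux : ∀ (e : k) (s : k[X]), s.natDegree ≤ n →
      (Polynomial.C e * s ^ 2).natDegree ≤ 2 * n := fun e s hs =>
    (natDegree_C_mul_le _ _).trans (natDegree_pow_le_of_le 2 hs)
  rw [pureNorm, ← Polynomial.C_mul]
  exact natDegree_sub_le_of_le
    (natDegree_add_le_of_degree_le (aux c p hp) (aux d q hq)) (aux _ r hr)
    |>.trans (max_self _).le

lemma coeff_pureNorm (p q r : k[X]) {n : ℕ} (hp : p.natDegree ≤ n)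
    (hq : q.natDegree ≤ n) (hr : r.natDegree ≤ n) :
    (pureNorm (Polynomial.C c) (Polynomial.C d) p q r).coeff (2 * n) =
      pureNorm c d (p.coeff n) (q.coeff n) (r.coeff n) := by
  simp only [pureNorm, ← Polynomial.C_mul, Polynomial.coeff_sub, Polynomial.coeff_add,
    Polynomial.coeff_C_mul, coeff_pow_of_natDegree_le hp, coeff_pow_of_natDegree_le hq,
    coeff_pow_of_natDegree_le hr]

/-- An anisotropic form over `k` does not lose degree on polynomial vectors. -/
lemma PureAnisotropic.natDegree_le (h : PureAnisotropic c d) (p q r : k[X]) {n : ℕ}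
    (hn : (pureNorm (Polynomial.C c) (Polynomial.C d) p q r).natDegree ≤ 2 * n) :
    p.natDegree ≤ n ∧ q.natDegree ≤ n ∧ r.natDegree ≤ n := by
  by_contra hcon
  obtain ⟨m, hm⟩ : ∃ m, m = max p.natDegree (max q.natDegree r.natDegree) := ⟨_, rfl⟩
  have hnm : n < m := by
    by_contra h'
    exact hcon ⟨by omega, by omega, by omega⟩
  have h0 := coeff_pureNorm (c := c) (d := d) p q r (n := m) (by omega) (by omega) (by omega)
  rw [coeff_eq_zero_of_natDegree_lt (by omega)] at h0
  obtain ⟨hp, hq, hr⟩ := h _ _ _ h0.symm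
  have key : ∀ s : k[X], s.coeff m = 0 → m ≠ 0 → s.natDegree ≠ m := by
    intro s hs hm0 hsm
    rw [← hsm, coeff_natDegree, leadingCoeff_eq_zero] at hs
    simp [hs] at hsm
    omega
  have := key p hp (by omega)
  have := key q hq (by omega)
  have := key r hr (by omega)
  omega

lemma PureAnisotropic.polynomial (h : PureAnisotropic c d) :
    PureAnisotropic (Polynomial.C c) (Polynomial.C d) := by
  intro p q r h0
  obtain ⟨hp, hq, hr⟩ := h.natDegree_le p q r (n := 0) (by simp [h0])
  rw [eq_C_of_natDegree_le_zero hp, eq_C_of_natDegree_le_zero hq,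
    eq_C_of_natDegree_le_zero hr] at h0 ⊢
  have := h (p.coeff 0) (q.coeff 0) (r.coeff 0) (by
    apply Polynomial.C_injective
    simpa [pureNorm] using h0)
  simpa using this

/-- The Cassels–Pfister theorem for anisotropic pure quaternion forms: a polynomial represented
over `k(X)` is represented over `k[X]`. -/
lemma PureAnisotropic.cassels_pfister (h : PureAnisotropic c d) (g : k[X]) (n : ℕ) :
    ∀ f p q r : k[X], f.natDegree ≤ n → f ≠ 0 →
      pureNorm (Polynomial.C c) (Polynomial.C d) p q r = f ^ 2 * g →
      ∃ p' q' r' : k[X], pureNorm (Polynomial.C c) (Polynomial.C d) p' q' r' = g := by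
  induction n using Nat.strong_induction_on with
  | _ n ih =>
  intro f p q r hfn hf hpqr
  have hp := EuclideanDomain.div_add_mod p f
  have hq := EuclideanDomain.div_add_mod q f
  have hr := EuclideanDomain.div_add_mod r f
  by_cases hs : pureNorm (Polynomial.C c) (Polynomial.C d) (p % f) (q % f) (r % f) = 0
  · obtain ⟨h1, h2, h3⟩ := h.polynomial _ _ _ hs
    rw [h1, add_zero] at hp
    rw [h2, add_zero] at hq
    rw [h3, add_zero] at hr
    refine ⟨p / f, q / f, r / f, mul_left_cancel₀ (pow_ne_zero 2 hf) ?_⟩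
    rw [← hpqr]
    conv_rhs => rw [← hp, ← hq, ← hr]
    simp only [pureNorm]
    ring
  have hf0 : f.natDegree ≠ 0 := by
    intro h0
    have hu : IsUnit f := isUnit_iff_degree_eq_zero.2 (by rw [degree_eq_natDegree hf, h0]; rfl)
    refine hs ?_
    rw [(EuclideanDomain.mod_eq_zero).2 hu.dvd, (EuclideanDomain.mod_eq_zero).2 hu.dvd,
      (EuclideanDomain.mod_eq_zero).2 hu.dvd]
    simp [pureNorm]
  have hdeg := natDegree_pureNorm_le (c := c) (d := d) (p % f) (q % f) (r % f)
    (Nat.le_sub_one_of_lt (natDegree_mod_lt p hf0)) (Nat.le_sub_one_of_lt (natDegree_mod_lt q hf0))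
    (Nat.le_sub_one_of_lt (natDegree_mod_lt r hf0))
  generalize p / f = u at *
  generalize q / f = v at *
  generalize r / f = w at *
  generalize p % f = s at *
  generalize q % f = t at *
  generalize r % f = z at *
  subst hp hq hr
  obtain ⟨B, hB⟩ : ∃ B, B = Polynomial.C c * u * s + Polynomial.C d * v * t
      - Polynomial.C c * Polynomial.C d * w * z := ⟨_, rfl⟩
  obtain ⟨N, hN⟩ : ∃ N, N = pureNorm (Polynomial.C c) (Polynomial.C d) u v w := ⟨_, rfl⟩
  obtain ⟨e, he⟩ : ∃ e, e = f * (g - N) - 2 * B := ⟨_, rfl⟩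
  have hfe : pureNorm (Polynomial.C c) (Polynomial.C d) s t z = f * e := by
    rw [he, hB, hN]
    simp only [pureNorm] at hpqr ⊢
    linear_combination hpqr
  have he0 : e ≠ 0 := by
    rintro rfl
    exact hs (by rw [hfe, mul_zero])
  rw [hfe, natDegree_mul hf he0] at hdeg
  refine ih e.natDegree (by omega) e (e * u + (N - g) * s) (e * v + (N - g) * t)
    (e * w + (N - g) * z) le_rfl he0 ?_
  have : pureNorm (Polynomial.C c) (Polynomial.C d) (e * u + (N - g) * s) (e * v + (N - g) * t)
      (e * w + (N - g) * z) = e ^ 2 * N + 2 * e * (N - g) * B +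
        (N - g) ^ 2 * pureNorm (Polynomial.C c) (Polynomial.C d) s t z := by
    rw [hB, hN]
    simp only [pureNorm]
    ring
  rw [this, hfe]
  linear_combination e * (N - g) * he

/-- A quadratic polynomial `α + βX²` represented over `k(X)` by an anisotropic pure quaternion
form splits into orthogonal vectors over `k` representing `α` and `β`. -/
lemma PureAnisotropic.exists_orthogonal (h : PureAnisotropic c d) (hchar : (2 : k) ≠ 0)
    (α β : k) {f p q r : k[X]} (hf : f ≠ 0)
    (hpqr : pureNorm (Polynomial.C c) (Polynomial.C d) p q r =
      f ^ 2 * (Polynomial.C α + Polynomial.C β * Polynomial.X ^ 2)) :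
    ∃ u v w s t z : k, pureNorm c d u v w = α ∧ pureNorm c d s t z = β ∧
      c * u * s + d * v * t - c * d * w * z = 0 := by
  obtain ⟨p', q', r', H⟩ := h.cassels_pfister _ _ f p q r le_rfl hf hpqr
  obtain ⟨hp, hq, hr⟩ := h.natDegree_le p' q' r' (n := 1) (by rw [H]; compute_degree)
  obtain ⟨p₁, p₀, rfl⟩ := exists_eq_X_add_C_of_natDegree_le_one hp
  obtain ⟨q₁, q₀, rfl⟩ := exists_eq_X_add_C_of_natDegree_le_one hq
  obtain ⟨r₁, r₀, rfl⟩ := exists_eq_X_add_C_of_natDegree_le_one hr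
  have H' : Polynomial.C (pureNorm c d p₀ q₀ r₀) +
      Polynomial.C (2 * (c * p₀ * p₁ + d * q₀ * q₁ - c * d * r₀ * r₁)) * Polynomial.X +
      Polynomial.C (pureNorm c d p₁ q₁ r₁) * Polynomial.X ^ 2 =
      Polynomial.C α + Polynomial.C β * Polynomial.X ^ 2 := by
    rw [← H]
    simp only [pureNorm, map_add, map_sub, map_mul, map_pow, map_ofNat]
    ring
  have h0 := congrArg (Polynomial.coeff · 0) H'
  have h1 := congrArg (Polynomial.coeff · 1) H'
  have h2 := congrArg (Polynomial.coeff · 2) H'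
  simp [Polynomial.coeff_X, Polynomial.coeff_C, Polynomial.coeff_X_pow, hchar] at h0 h1 h2
  exact ⟨p₀, q₀, r₀, p₁, q₁, r₁, h0, h2, h1⟩

end PolynomialForms

/-- `(x, y)` is a generic point of the conic `a·x² + b·y² = 1` generating `K` over `k`. -/
structure IsGenericConicPoint {k K : Type*} [Field k] [Field K] [Algebra k K] (a b : k)
    (x y : K) : Prop where
  conic : algebraMap k K a * x ^ 2 + algebraMap k K b * y ^ 2 = 1
  transcendental : Transcendental k x
  adjoin : IntermediateField.adjoin k {x, y} = ⊤

section FunctionField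

variable {k : Type*} [Field k] {a b : k}

/-- Every polynomial function on the conic is of the form `p(x) + q(x)·y`. -/
lemma exists_aeval_eq_add_mul {S : Type*} [CommRing S] [Algebra k S] (hb : b ≠ 0) {x y : S}
    (hxy : algebraMap k S a * x ^ 2 + algebraMap k S b * y ^ 2 = 1)
    (P : MvPolynomial (Fin 2) k) :
    ∃ p q : Polynomial k, aeval ![x, y] P = Polynomial.aeval x p + Polynomial.aeval x q * y := by
  have hb' : algebraMap k S b⁻¹ * algebraMap k S b = 1 := by
    rw [← map_mul, inv_mul_cancel₀ hb, map_one]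
  induction P using MvPolynomial.induction_on with
  | C e => exact ⟨Polynomial.C e, 0, by simp⟩
  | add P Q hP hQ =>
    obtain ⟨p, q, h⟩ := hP
    obtain ⟨p', q', h'⟩ := hQ
    exact ⟨p + p', q + q', by simp only [map_add, h, h']; ring⟩
  | mul_X P i hP =>
    obtain ⟨p, q, h⟩ := hP
    fin_cases i
    · exact ⟨p * Polynomial.X, q * Polynomial.X, by simp [h]; ring⟩
    · refine ⟨q * (Polynomial.C b⁻¹ * (1 - Polynomial.C a * Polynomial.X ^ 2)), p, ?_⟩
      simp [h]
      linear_combination -Polynomial.aeval x q * y ^ 2 * hb' +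
        Polynomial.aeval x q * algebraMap k S b⁻¹ * hxy

/-- On a conic with transcendental first coordinate, `1` and `y` are linearly independent over
the polynomials in `x`. -/
lemma eq_zero_of_aeval_add_mul_eq_zero {K : Type*} [Field K] [Algebra k K]
    (hchar : (2 : k) ≠ 0) (ha : a ≠ 0) {x y : K}
    (hxy : algebraMap k K a * x ^ 2 + algebraMap k K b * y ^ 2 = 1) (hx : Transcendental k x)
    {p q : Polynomial k} (h : Polynomial.aeval x p + Polynomial.aeval x q * y = 0) :
    p = 0 ∧ q = 0 := by
  have hinj := transcendental_iff_injective.1 hx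
  have hpq : Polynomial.C b * p ^ 2 = q ^ 2 * (1 - Polynomial.C a * Polynomial.X ^ 2) := by
    apply hinj
    simp only [map_mul, map_pow, map_sub, map_one, Polynomial.aeval_C, Polynomial.aeval_X]
    linear_combination algebraMap k K b * (Polynomial.aeval x p - Polynomial.aeval x q * y) * h +
      Polynomial.aeval x q ^ 2 * hxy
  suffices hq : q = 0 by
    subst hq
    simp only [map_zero, zero_mul, add_zero] at h
    exact ⟨hinj (by simpa using h), rfl⟩
  by_contra hq
  have hb : b ≠ 0 := by
    rintro rfl
    have : (1 - Polynomial.C a * Polynomial.X ^ 2 : Polynomial k) = 0 := by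
      simpa [hq] using hpq
    simpa using congrArg (Polynomial.coeff · 0) this
  have hdvd : q ∣ p := by
    rw [← UniqueFactorizationMonoid.pow_dvd_pow_iff_dvd two_ne_zero]
    refine ⟨Polynomial.C b⁻¹ * (1 - Polynomial.C a * Polynomial.X ^ 2), ?_⟩
    have : Polynomial.C b⁻¹ * Polynomial.C b = 1 := by
      rw [← Polynomial.C_mul, inv_mul_cancel₀ hb, Polynomial.C_1]
    linear_combination -p ^ 2 * this + Polynomial.C b⁻¹ * hpq
  obtain ⟨r, rfl⟩ := hdvd
  have hr : Polynomial.C b * r ^ 2 = 1 - Polynomial.C a * Polynomial.X ^ 2 :=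
    mul_left_cancel₀ (pow_ne_zero 2 hq) (by linear_combination hpq)
  have hdeg : r.natDegree ≤ 1 := by
    have h1 := congrArg Polynomial.natDegree hr
    rw [Polynomial.natDegree_C_mul hb, Polynomial.natDegree_pow] at h1
    have : (1 - Polynomial.C a * Polynomial.X ^ 2 : Polynomial k).natDegree ≤ 2 := by
      compute_degree
    omega
  obtain ⟨s, t, rfl⟩ := Polynomial.exists_eq_X_add_C_of_natDegree_le_one hdeg
  have hr' : Polynomial.C (b * t ^ 2) + Polynomial.C (2 * b * s * t) * Polynomial.X +
      Polynomial.C (b * s ^ 2) * Polynomial.X ^ 2 = 1 - Polynomial.C a * Polynomial.X ^ 2 := by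
    rw [← hr]
    simp only [map_mul, map_pow, map_ofNat]
    ring
  have h0 := congrArg (Polynomial.coeff · 0) hr'
  have h1 := congrArg (Polynomial.coeff · 1) hr'
  have h2 := congrArg (Polynomial.coeff · 2) hr'
  simp only [Polynomial.coeff_add, Polynomial.coeff_sub, Polynomial.coeff_C_mul,
    Polynomial.coeff_X, Polynomial.coeff_C, Polynomial.coeff_X_pow,
    Polynomial.coeff_one] at h0 h1 h2
  simp [hchar, hb] at h0 h1 h2
  rcases h1 with rfl | rfl
  · simp [ha] at h2
  · simp at h0

lemma ConicRing.conic :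
    algebraMap k (ConicRing k a b) a * Ideal.Quotient.mk _ (X 0) ^ 2 +
      algebraMap k (ConicRing k a b) b * Ideal.Quotient.mk _ (X 1) ^ 2 = 1 := by
  rw [← sub_eq_zero]
  exact Ideal.Quotient.eq_zero_iff_mem.2 (Ideal.subset_span rfl)

/-- Every element of the coordinate ring is of the form `p(x) + q(x)·y`. -/
lemma ConicRing.exists_eq (hb : b ≠ 0) (r : ConicRing k a b) :
    ∃ p q : Polynomial k, r = Polynomial.aeval (Ideal.Quotient.mk _ (X 0)) p +
      Polynomial.aeval (Ideal.Quotient.mk _ (X 0)) q * Ideal.Quotient.mk _ (X 1) := by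
  set I := Ideal.span {conicPoly k a b} with hI
  have haeval : (aeval ![Ideal.Quotient.mk I (X 0), Ideal.Quotient.mk I (X 1)] :
      MvPolynomial (Fin 2) k →ₐ[k] ConicRing k a b) = Ideal.Quotient.mkₐ k I := by
    ext i
    fin_cases i <;> simp
  obtain ⟨P, rfl⟩ := Ideal.Quotient.mk_surjective r
  obtain ⟨p, q, hpq⟩ := exists_aeval_eq_add_mul hb (ConicRing.conic (k := k) (a := a) (b := b)) P
  rw [haeval, Ideal.Quotient.mkₐ_eq_mk] at hpq
  exact ⟨p, q, hpq⟩

lemma ConicRing.exists_map_eq {S : Type*} [CommRing S] [Algebra k S] (hb : b ≠ 0)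
    (F : ConicRing k a b →ₐ[k] S) {x y : S} (hx : F (Ideal.Quotient.mk _ (X 0)) = x)
    (hy : F (Ideal.Quotient.mk _ (X 1)) = y) (r : ConicRing k a b) :
    ∃ p q : Polynomial k, F r = Polynomial.aeval x p + Polynomial.aeval x q * y := by
  obtain ⟨p, q, rfl⟩ := ConicRing.exists_eq hb r
  exact ⟨p, q, by rw [map_add, map_mul, ← Polynomial.aeval_algHom_apply,
    ← Polynomial.aeval_algHom_apply, hx, hy]⟩

lemma ConicRing.exists_algHom {S : Type*} [CommRing S] [Algebra k S] {x y : S}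
    (hxy : algebraMap k S a * x ^ 2 + algebraMap k S b * y ^ 2 = 1) :
    ∃ F : ConicRing k a b →ₐ[k] S, F (Ideal.Quotient.mk _ (X 0)) = x ∧
      F (Ideal.Quotient.mk _ (X 1)) = y := by
  refine ⟨Ideal.Quotient.liftₐ _ (aeval ![x, y]) ?_, ?_, ?_⟩
  · intro P hP
    refine (Ideal.span_singleton_le_iff_mem (RingHom.ker (aeval ![x, y]))).2 ?_ hP
    rw [RingHom.mem_ker]
    simp [conicPoly, hxy]
  · exact (Ideal.Quotient.lift_mk _ _ _).trans (by simp)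
  · exact (Ideal.Quotient.lift_mk _ _ _).trans (by simp)

/-- The first coordinate function on the affine conic is transcendental. -/
lemma ConicRing.transcendental_mk_X (hb : b ≠ 0) :
    Transcendental k (Ideal.Quotient.mk (Ideal.span {conicPoly k a b}) (X 0)) := by
  let F := AlgebraicClosure (RatFunc k)
  let x : F := algebraMap (RatFunc k) F RatFunc.X
  have hx : Transcendental k x :=
    (transcendental_algebraMap_iff (algebraMap (RatFunc k) F).injective).2 RatFunc.transcendental_X
  have hbF : algebraMap k F b ≠ 0 := by simpa using hb
  obtain ⟨y, hy⟩ := IsAlgClosed.exists_pow_nat_eq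
    ((1 - algebraMap k F a * x ^ 2) / algebraMap k F b) (n := 2) two_pos
  obtain ⟨g, hg, -⟩ := ConicRing.exists_algHom (k := k) (a := a) (b := b) (x := x) (y := y)
    (by rw [hy, mul_div_cancel₀ _ hbF]; ring)
  intro halg
  exact hx (hg ▸ halg.algHom g)

/-- The coordinate functions form a generic point of the function field of the conic. -/
lemma IsConicFunctionField.exists_algHom (hb : b ≠ 0) {K : Type*} [Field K] [Algebra k K]
    (hK : IsConicFunctionField k a b K (algebraMap k K)) :
    ∃ F : ConicRing k a b →ₐ[k] K, IsGenericConicPoint a b (F (Ideal.Quotient.mk _ (X 0)))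
      (F (Ideal.Quotient.mk _ (X 1))) ∧ ∀ z, ∃ p q, F q ≠ 0 ∧ z = F p / F q := by
  obtain ⟨f, hf, hfk, hdiv⟩ := hK
  let F : ConicRing k a b →ₐ[k] K := { f with commutes' := fun r => congrArg (· r) hfk }
  refine ⟨F, ⟨?_, ?_, ?_⟩, hdiv⟩
  · simpa using congrArg F ConicRing.conic
  · intro h
    exact ConicRing.transcendental_mk_X hb ((isAlgebraic_algHom_iff F hf).1 h)
  · rw [eq_top_iff]
    rintro z -
    have hmem : ∀ r, F r ∈ IntermediateField.adjoin k
        {F (Ideal.Quotient.mk _ (X 0)), F (Ideal.Quotient.mk _ (X 1))} := by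
      intro r
      obtain ⟨p, q, hpq⟩ := ConicRing.exists_map_eq hb F rfl rfl r
      rw [hpq]
      generalize F (Ideal.Quotient.mk _ (X 0)) = x
      generalize F (Ideal.Quotient.mk _ (X 1)) = y
      have hx : x ∈ IntermediateField.adjoin k {x, y} :=
        IntermediateField.mem_adjoin_pair_left k x y
      have haeval : ∀ s : Polynomial k,
          Polynomial.aeval x s ∈ IntermediateField.adjoin k {x, y} := fun s => by
        rw [show x = (IntermediateField.adjoin k {x, y}).val ⟨x, hx⟩ from rfl,
          Polynomial.aeval_algHom_apply]
        exact SetLike.coe_mem _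
      exact add_mem (haeval p) (mul_mem (haeval q)
        (IntermediateField.mem_adjoin_pair_right k x y))
    obtain ⟨p, q, -, rfl⟩ := hdiv z
    exact div_mem (hmem p) (hmem q)

/-- A field generated by a generic point of the conic is a function field of the conic. -/
lemma IsGenericConicPoint.isConicFunctionField (hchar : (2 : k) ≠ 0) (ha : a ≠ 0) (hb : b ≠ 0)
    {K : Type*} [Field K] [Algebra k K] {x y : K} (h : IsGenericConicPoint a b x y) :
    IsConicFunctionField k a b K (algebraMap k K) := by
  obtain ⟨hxy, hx, hgen⟩ := h
  obtain ⟨F, hFx, hFy⟩ := ConicRing.exists_algHom hxy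
  refine ⟨F, ?_, F.comp_algebraMap, fun z => ?_⟩
  · rw [injective_iff_map_eq_zero]
    intro r hr
    obtain ⟨p, q, rfl⟩ := ConicRing.exists_eq hb r
    rw [RingHom.coe_coe, map_add, map_mul, ← Polynomial.aeval_algHom_apply,
      ← Polynomial.aeval_algHom_apply, hFx, hFy] at hr
    obtain ⟨rfl, rfl⟩ := eq_zero_of_aeval_add_mul_eq_zero hchar ha hxy hx hr
    simp
  · have hz : z ∈ IntermediateField.adjoin k {x, y} := hgen ▸ IntermediateField.mem_top
    obtain ⟨r, hr, s, hs, rfl⟩ := IntermediateField.mem_adjoin_iff_div.1 hz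
    have hrange : Algebra.adjoin k {x, y} ≤ F.range := Algebra.adjoin_le <| by
      rintro _ (rfl | rfl)
      · exact ⟨_, hFx⟩
      · exact ⟨_, hFy⟩
    obtain ⟨p, rfl⟩ := hrange hr
    obtain ⟨q, rfl⟩ := hrange hs
    by_cases hq : F q = 0
    · exact ⟨0, 1, by simp, by simp [hq]⟩
    · exact ⟨p, q, hq, rfl⟩

/-- Function fields of the same conic are isomorphic over `k`. -/
lemma IsConicFunctionField.exists_ringEquiv {K L : Type*} [Field K] [Field L] {ι : k →+* K}
    {ι' : k →+* L} (hK : IsConicFunctionField k a b K ι)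
    (hL : IsConicFunctionField k a b L ι') : ∃ e : K ≃+* L, ∀ r : k, e (ι r) = ι' r := by
  obtain ⟨f, hf, rfl, hfdiv⟩ := hK
  obtain ⟨g, hg, rfl, hgdiv⟩ := hL
  let := f.toAlgebra
  let := g.toAlgebra
  have : FaithfulSMul (ConicRing k a b) K := (faithfulSMul_iff_algebraMap_injective _ _).2 hf
  have : FaithfulSMul (ConicRing k a b) L := (faithfulSMul_iff_algebraMap_injective _ _).2 hg
  have : IsFractionRing (ConicRing k a b) K := .of_field _ _ fun z =>
    let ⟨p, q, _, hz⟩ := hfdiv z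
    ⟨p, q, hz⟩
  have : IsFractionRing (ConicRing k a b) L := .of_field _ _ fun z =>
    let ⟨p, q, _, hz⟩ := hgdiv z
    ⟨p, q, hz⟩
  let e := IsLocalization.algEquiv (nonZeroDivisors (ConicRing k a b)) K L
  exact ⟨e, fun r => e.commutes _⟩

end FunctionField

section ChangeOfConic

open Matrix

variable {k : Type*} [Field k] {a b c d : k}

lemma IsGenericConicPoint.eq_zero_of_linear {K : Type*} [Field K] [Algebra k K] {x y : K}
    (h : IsGenericConicPoint a b x y) (hchar : (2 : k) ≠ 0) (ha : a ≠ 0) {r s t : k}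
    (h0 : algebraMap k K r * y + algebraMap k K s * x + algebraMap k K t = 0) :
    r = 0 ∧ s = 0 ∧ t = 0 := by
  obtain ⟨hp, hq⟩ := eq_zero_of_aeval_add_mul_eq_zero hchar ha h.conic h.transcendental
    (p := Polynomial.C s * Polynomial.X + Polynomial.C t) (q := Polynomial.C r)
    (by simp only [map_add, map_mul, Polynomial.aeval_C, Polynomial.aeval_X]
        linear_combination h0)
  have h1 := congrArg (Polynomial.coeff · 1) hp
  have h2 := congrArg (Polynomial.coeff · 0) hp
  exact ⟨by simpa using hq, by simpa [Polynomial.coeff_C] using h1, by simpa using h2⟩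

/-- An isometry of pure quaternion forms carries a generic point of one conic to a generic point
of the other. -/
lemma IsGenericConicPoint.exists_of_isometry {K : Type*} [Field K] [Algebra k K] {x y : K}
    (h : IsGenericConicPoint a b x y) (hchar : (2 : k) ≠ 0) (ha : a ≠ 0) (hb : b ≠ 0)
    (hc : c ≠ 0) (hd : d ≠ 0) (m : Matrix (Fin 3) (Fin 3) k)
    (hm : mᵀ * diagonal ![c, d, -(c * d)] * m = diagonal ![a, b, -(a * b)]) :
    ∃ x' y' : K, IsGenericConicPoint c d x' y' := by
  have hdet : m.det ≠ 0 := by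
    intro h0
    have := congrArg det hm
    simp [det_mul, h0, Fin.prod_univ_three, ha, hb] at this
  set A := algebraMap k K with hA
  have hcA : A c ≠ 0 := by simpa using hc
  have hdA : A d ≠ 0 := by simpa using hd
  have haA : A a ≠ 0 := by simpa using ha
  have hbA : A b ≠ 0 := by simpa using hb
  set v : Fin 3 → K := ![A b * y, A a * x, 1] with hv
  set v' : Fin 3 → K := m.map A *ᵥ v with hv'
  have hform : A c * v' 0 ^ 2 + A d * v' 1 ^ 2 = A c * A d * v' 2 ^ 2 := by
    have h1 : v' ⬝ᵥ ((diagonal ![c, d, -(c * d)]).map A *ᵥ v') =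
        v ⬝ᵥ ((diagonal ![a, b, -(a * b)]).map A *ᵥ v) := by
      rw [← hm, Matrix.map_mul, Matrix.map_mul, hv', ← mulVec_mulVec, ← mulVec_mulVec,
        dotProduct_mulVec v, transpose_map, vecMul_transpose]
    simp [dotProduct, mulVec, Fin.sum_univ_three, diagonal, hv] at h1
    linear_combination h1 + A a * A b * h.conic
  have hw : v' 2 ≠ 0 := by
    intro h0
    have h1 : A (m 2 0 * b) * y + A (m 2 1 * a) * x + A (m 2 2) = 0 := by
      rw [← h0]
      simp [hv', hv, mulVec, dotProduct, Fin.sum_univ_three]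
      ring
    obtain ⟨h2, h3, h4⟩ := h.eq_zero_of_linear hchar ha h1
    refine hdet (det_eq_zero_of_row_eq_zero 2 fun j => ?_)
    fin_cases j
    · simpa [hb] using h2
    · simpa [ha] using h3
    · simpa using h4
  refine ⟨v' 1 / (A c * v' 2), v' 0 / (A d * v' 2), ?_⟩
  have hconic : A c * (v' 1 / (A c * v' 2)) ^ 2 + A d * (v' 0 / (A d * v' 2)) ^ 2 = 1 := by
    field_simp
    linear_combination hform
  set x' := v' 1 / (A c * v' 2) with hx'
  set y' := v' 0 / (A d * v' 2) with hy'
  set S := IntermediateField.adjoin k {x', y'} with hS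
  have hxS : x' ∈ S := IntermediateField.mem_adjoin_pair_left k x' y'
  have hyS : y' ∈ S := IntermediateField.mem_adjoin_pair_right k x' y'
  have hvS : ∀ i, v i / v' 2 ∈ S := by
    intro i
    have h1 : v = m⁻¹.map A *ᵥ v' := by
      rw [hv', mulVec_mulVec, ← Matrix.map_mul, nonsing_inv_mul _ (Ne.isUnit hdet)]
      simp
    have h2 : v i / v' 2 = A (m⁻¹ i 0) * (A d * y') + A (m⁻¹ i 1) * (A c * x') + A (m⁻¹ i 2) := by
      rw [h1, hx', hy']
      simp only [mulVec, dotProduct, Fin.sum_univ_three, map_apply]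
      field_simp
    rw [h2]
    have hAS : ∀ r, A r ∈ S := S.algebraMap_mem
    exact add_mem (add_mem (mul_mem (hAS _) (mul_mem (hAS _) hyS))
      (mul_mem (hAS _) (mul_mem (hAS _) hxS))) (hAS _)
  have hwS : (v' 2)⁻¹ ∈ S := by simpa [hv] using hvS 2
  have hxyS : x ∈ S ∧ y ∈ S := by
    have h1 : x = (A a)⁻¹ * (v 1 / v' 2) * ((v' 2)⁻¹)⁻¹ := by simp [hv]; field_simp
    have h0 : y = (A b)⁻¹ * (v 0 / v' 2) * ((v' 2)⁻¹)⁻¹ := by simp [hv]; field_simp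
    rw [h1, h0]
    exact ⟨mul_mem (mul_mem (inv_mem (S.algebraMap_mem _)) (hvS 1)) (inv_mem hwS),
      mul_mem (mul_mem (inv_mem (S.algebraMap_mem _)) (hvS 0)) (inv_mem hwS)⟩
  refine ⟨hconic, fun halg => h.transcendental ?_, ?_⟩
  · have hint : IsIntegral k x' := halg.isIntegral
    have hint' : IsIntegral k y' := by
      refine IsIntegral.of_pow two_pos (?_ : IsIntegral k (y' ^ 2))
      rw [show y' ^ 2 = A d⁻¹ * (1 - A c * x' ^ 2) by
        rw [map_inv₀]; field_simp; linear_combination hconic]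
      exact isIntegral_algebraMap.mul
        (isIntegral_one.sub (isIntegral_algebraMap.mul (hint.pow 2)))
    have : Algebra.IsAlgebraic k S := IntermediateField.isAlgebraic_adjoin <| by
      rintro _ (rfl | rfl)
      · exact hint
      · exact hint'
    exact (isAlgebraic_algHom_iff S.val S.val.injective).2
      (Algebra.IsAlgebraic.isAlgebraic (⟨x, hxyS.1⟩ : S))
  · rw [eq_top_iff, ← h.adjoin, IntermediateField.adjoin_le_iff]
    rintro _ (rfl | rfl)
    · exact hxyS.1
    · exact hxyS.2

end ChangeOfConic

section PointsOverFunctionField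

variable {k : Type*} [Field k] {a b c d : k}

/-- If an anisotropic pure quaternion form of `(c,d/k)` acquires a zero over the function field
`k_{a,b}`, then it represents `b` and `-ab` by orthogonal vectors. -/
lemma PureAnisotropic.exists_orthogonal_of_point (h : PureAnisotropic c d) (hchar : (2 : k) ≠ 0)
    (ha : a ≠ 0) (hb : b ≠ 0) {K : Type*} [Field K] [Algebra k K]
    (hK : IsConicFunctionField k a b K (algebraMap k K)) {X' Y' : K}
    (hXY : algebraMap k K c * X' ^ 2 + algebraMap k K d * Y' ^ 2 = 1) :
    ∃ u v w s t z : k, pureNorm c d u v w = b ∧ pureNorm c d s t z = -(a * b) ∧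
      c * u * s + d * v * t - c * d * w * z = 0 := by
  obtain ⟨F, hF, hdiv⟩ := hK.exists_algHom hb
  obtain ⟨p₁, q₁, hq₁, rfl⟩ := hdiv X'
  obtain ⟨p₂, q₂, hq₂, rfl⟩ := hdiv Y'
  obtain ⟨u₀, u₁, hu⟩ := ConicRing.exists_map_eq hb F rfl rfl
    (algebraMap k _ d * p₂ * q₁)
  obtain ⟨v₀, v₁, hv⟩ := ConicRing.exists_map_eq hb F rfl rfl
    (algebraMap k _ c * p₁ * q₂)
  obtain ⟨w₀, w₁, hw⟩ := ConicRing.exists_map_eq hb F rfl rfl (q₁ * q₂)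
  have hxy := hF.conic
  have hx := hF.transcendental
  set x := F (Ideal.Quotient.mk _ (X 0))
  set y := F (Ideal.Quotient.mk _ (X 1))
  have hzero : pureNorm (algebraMap k K c) (algebraMap k K d)
      (F (algebraMap k _ d * p₂ * q₁)) (F (algebraMap k _ c * p₁ * q₂)) (F (q₁ * q₂)) = 0 := by
    simp only [map_mul, AlgHom.commutes, pureNorm]
    field_simp at hXY
    linear_combination algebraMap k K c * algebraMap k K d * hXY
  have hw0 : F (q₁ * q₂) ≠ 0 := by
    rw [map_mul]
    exact mul_ne_zero hq₁ hq₂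
  rw [hw] at hw0
  rw [hu, hv, hw] at hzero
  set B := Polynomial.C c * u₀ * u₁ + Polynomial.C d * v₀ * v₁
      - Polynomial.C c * Polynomial.C d * w₀ * w₁ with hB
  set N₀ := pureNorm (Polynomial.C c) (Polynomial.C d) u₀ v₀ w₀ with hN₀
  set N₁ := pureNorm (Polynomial.C c) (Polynomial.C d) u₁ v₁ w₁ with hN₁
  obtain ⟨h0, h1⟩ := eq_zero_of_aeval_add_mul_eq_zero hchar ha hxy hx
    (p := Polynomial.C b * N₀ + (1 - Polynomial.C a * Polynomial.X ^ 2) * N₁)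
    (q := 2 * Polynomial.C b * B) (by
      simp only [hB, hN₀, hN₁, pureNorm, map_add, map_sub, map_mul, map_pow, map_one, map_ofNat,
        Polynomial.aeval_C, Polynomial.aeval_X] at hzero ⊢
      linear_combination algebraMap k K b * hzero - (algebraMap k K c * Polynomial.aeval x u₁ ^ 2 +
        algebraMap k K d * Polynomial.aeval x v₁ ^ 2 -
        algebraMap k K c * algebraMap k K d * Polynomial.aeval x w₁ ^ 2) * hxy)
  have hCb : Polynomial.C b ≠ 0 := by simpa using hb
  have hB0 : B = 0 := by
    have h2 : (2 : Polynomial k) ≠ 0 := by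
      rw [← map_ofNat Polynomial.C 2]
      simpa using hchar
    simpa [h2, hCb] using h1
  have hN₁0 : N₁ ≠ 0 := by
    intro hN
    have hN' : N₀ = 0 := by simpa [hN, hCb] using h0
    obtain ⟨-, -, rfl⟩ := h.polynomial _ _ _ hN
    obtain ⟨-, -, rfl⟩ := h.polynomial _ _ _ hN'
    simp at hw0
  refine h.exists_orthogonal hchar b (-(a * b)) hN₁0
    (p := Polynomial.C b * Polynomial.C d * (w₀ * v₁ - v₀ * w₁))
    (q := Polynomial.C b * Polynomial.C c * (u₀ * w₁ - w₀ * u₁))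
    (r := Polynomial.C b * (u₀ * v₁ - v₀ * u₁)) ?_
  have hcross : pureNorm (Polynomial.C c) (Polynomial.C d)
      (Polynomial.C b * Polynomial.C d * (w₀ * v₁ - v₀ * w₁))
      (Polynomial.C b * Polynomial.C c * (u₀ * w₁ - w₀ * u₁))
      (Polynomial.C b * (u₀ * v₁ - v₀ * u₁)) = Polynomial.C b ^ 2 * (B ^ 2 - N₀ * N₁) := by
    simp only [hB, hN₀, hN₁, pureNorm]
    ring
  rw [hcross, hB0]
  simp only [map_neg, map_mul]
  linear_combination -Polynomial.C b * N₁ * h0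

end PointsOverFunctionField

section QuaternionBases

open Quaternion

variable {k : Type*} [Field k] {a b c d : k}

lemma re_eq_zero_of_anticomm (hchar : (2 : k) ≠ 0) {β : k} (hβ : β ≠ 0) {x y : ℍ[k, c, d]}
    (hy : y * y = β • 1) (h : y * x = -(x * y)) : x.re = 0 := by
  have h1 : x * y * y = β • x := by rw [mul_assoc, hy, mul_smul_comm, mul_one]
  have h2 : y * (x * y) = -(β • x) := by rw [← mul_assoc, h, neg_mul, h1]
  have h3 : (x * y * y).re = (y * (x * y)).re := by
    generalize x * y = z
    simp
    ring
  rw [h1, h2] at h3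
  simp at h3
  have h4 : 2 * β * x.re = 0 := by linear_combination h3
  simpa [hchar, hβ] using h4

lemma QuaternionAlgebra.Basis.exists_isometry (hchar : (2 : k) ≠ 0) (ha : a ≠ 0) (hb : b ≠ 0)
    (q : QuaternionAlgebra.Basis ℍ[k, c, d] a 0 b) :
    ∃ m : Matrix (Fin 3) (Fin 3) k, m.transpose * Matrix.diagonal ![c, d, -(c * d)] * m =
      Matrix.diagonal ![a, b, -(a * b)] := by
  have hii : q.i * q.i = a • 1 := by simp
  have hjj : q.j * q.j = b • 1 := by simp
  have hi : q.i.re = 0 := re_eq_zero_of_anticomm hchar hb hjj (by simp)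
  have hj : q.j.re = 0 := re_eq_zero_of_anticomm hchar ha hii (by simp)
  have hk : q.k.re = 0 := re_eq_zero_of_anticomm hchar ha hii (by simp)
  let e : Fin 3 → ℍ[k, c, d] := ![q.i, q.j, q.k]
  refine ⟨Matrix.of fun r s => ![(e s).imI, (e s).imJ, (e s).imK] r, ?_⟩
  have hre : ∀ s, (e s).re = 0 := by
    intro s
    fin_cases s <;> assumption
  have hmul : ∀ s t, (e s * e t).re = Matrix.diagonal ![a, b, -(a * b)] s t := by
    intro s t
    fin_cases s <;> fin_cases t <;> simp [e, -QuaternionAlgebra.re_mul, hi, hj, hk]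
  ext s t
  rw [← hmul, QuaternionAlgebra.re_mul, hre, hre, Matrix.mul_apply]
  simp [Fin.sum_univ_three, Matrix.mul_diagonal]
  ring

lemma algHom_re_eq_zero {A : Type*} [Ring A] [Nontrivial A] [Algebra k A]
    (hchar : (2 : k) ≠ 0) (ha : a ≠ 0) (hb : b ≠ 0) (F : ℍ[k, a, b] →ₐ[k] A) {x : ℍ[k, a, b]}
    (hx : F x = 0) : x.re = 0 := by
  have h1 : algebraMap k ℍ[k, a, b] (4 * x.re) = x + a⁻¹ • (⟨0, 1, 0, 0⟩ * x * ⟨0, 1, 0, 0⟩) +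
      b⁻¹ • (⟨0, 0, 1, 0⟩ * x * ⟨0, 0, 1, 0⟩) -
      (a * b)⁻¹ • (⟨0, 0, 0, 1⟩ * x * ⟨0, 0, 0, 1⟩) := by
    ext <;> simp [QuaternionAlgebra.algebraMap_eq] <;> field_simp <;> ring
  have h2 := congrArg F h1
  rw [AlgHom.commutes] at h2
  have h4 : (4 : k) ≠ 0 := by
    rw [show (4 : k) = 2 * 2 by norm_num]
    exact mul_ne_zero hchar hchar
  have h5 : algebraMap k A (4 * x.re) = 0 := by
    rw [h2]
    simp [hx]
  simpa [h4] using (map_eq_zero_iff _ (algebraMap k A).injective).1 h5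

lemma algHom_injective {A : Type*} [Ring A] [Nontrivial A] [Algebra k A]
    (hchar : (2 : k) ≠ 0) (ha : a ≠ 0) (hb : b ≠ 0) (F : ℍ[k, a, b] →ₐ[k] A) :
    Function.Injective F := by
  rw [injective_iff_map_eq_zero]
  intro x hx
  have key : ∀ y, (y * x).re = 0 := fun y =>
    algHom_re_eq_zero hchar ha hb F (by rw [map_mul, hx, mul_zero])
  have h0 := key 1
  have h1 := key ⟨0, 1, 0, 0⟩
  have h2 := key ⟨0, 0, 1, 0⟩
  have h3 := key ⟨0, 0, 0, 1⟩
  ext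
  · simpa using h0
  · simpa [ha] using h1
  · simpa [hb] using h2
  · simpa [ha, hb] using h3

lemma QuaternionAlgebra.Basis.nonempty_algEquiv_s4 (hchar : (2 : k) ≠ 0) (ha : a ≠ 0) (hb : b ≠ 0)
    (q : QuaternionAlgebra.Basis ℍ[k, c, d] a 0 b) :
    Nonempty (ℍ[k, a, b] ≃ₐ[k] ℍ[k, c, d]) := by
  have hinj := algHom_injective hchar ha hb q.liftHom
  have hfin : Module.finrank k ℍ[k, a, b] = Module.finrank k ℍ[k, c, d] := by
    rw [QuaternionAlgebra.finrank_eq_four, QuaternionAlgebra.finrank_eq_four]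
  exact ⟨AlgEquiv.ofBijective q.liftHom ⟨hinj,
    (LinearMap.injective_iff_surjective_of_finrank_eq_finrank hfin
      (f := q.liftHom.toLinearMap)).1 hinj⟩⟩

lemma nonempty_algEquiv_of_orthogonal (hchar : (2 : k) ≠ 0) (ha : a ≠ 0) (hb : b ≠ 0)
    {u v w s t z : k} (h1 : pureNorm c d u v w = b) (h2 : pureNorm c d s t z = -(a * b))
    (h3 : c * u * s + d * v * t - c * d * w * z = 0) :
    Nonempty (ℍ[k, a, b] ≃ₐ[k] ℍ[k, c, d]) := by
  let j : ℍ[k, c, d] := ⟨0, u, v, w⟩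
  let l : ℍ[k, c, d] := ⟨0, s, t, z⟩
  rw [pureNorm] at h1 h2
  have hj : j * j = b • 1 := by
    rw [← h1]
    ext <;> simp [j] <;> ring
  have hl : l * l = -(a * b) • 1 := by
    rw [← h2]
    ext <;> simp [l] <;> ring
  have hlj : l * j = -(j * l) := by
    ext <;> simp [j, l]
    · linear_combination 2 * h3
    all_goals ring
  have hij : j * l * j = -(b • l) := by
    rw [mul_assoc, hlj, mul_neg, ← mul_assoc, hj, smul_mul_assoc, one_mul]
  refine QuaternionAlgebra.Basis.nonempty_algEquiv_s4 hchar ha hb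
    { i := b⁻¹ • (j * l), j := j, k := -l, i_mul_i := ?_, j_mul_j := hj, i_mul_j := ?_,
      j_mul_i := ?_ }
  · rw [smul_mul_smul_comm, ← mul_assoc (j * l), hij, neg_mul, smul_mul_assoc, hl]
    match_scalars <;> field_simp
    ring
  · rw [smul_mul_assoc, hij, smul_neg, smul_smul, inv_mul_cancel₀ hb, one_smul]
  · rw [mul_smul_comm, ← mul_assoc, hj, smul_mul_assoc, one_mul, smul_smul, inv_mul_cancel₀ hb]
    simp

lemma exists_hyperbolic_partner {u v w : k} (hchar : (2 : k) ≠ 0) (hc : c ≠ 0) (hd : d ≠ 0)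
    (h : ¬(u = 0 ∧ v = 0 ∧ w = 0)) :
    ∃ (m : ℍ[k, c, d]) (μ : k), m * m = μ • 1 ∧
      (⟨0, u, v, w⟩ : ℍ[k, c, d]) * m + m * ⟨0, u, v, w⟩ = 1 := by
  by_cases hu : u = 0
  · by_cases hv : v = 0
    · have hw : w ≠ 0 := fun hw => h ⟨hu, hv, hw⟩
      refine ⟨(-(2 * c * d * w)⁻¹) • ⟨0, 0, 0, 1⟩, (2 * c * d * w)⁻¹ ^ 2 * (-(c * d)), ?_, ?_⟩
      · ext <;> simp; ring
      · ext <;> simp [hu, hv]; field_simp; ring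
    · refine ⟨(2 * d * v)⁻¹ • ⟨0, 0, 1, 0⟩, (2 * d * v)⁻¹ ^ 2 * d, ?_, ?_⟩
      · ext <;> simp; ring
      · ext <;> simp <;> field_simp <;> ring
  · refine ⟨(2 * c * u)⁻¹ • ⟨0, 1, 0, 0⟩, (2 * c * u)⁻¹ ^ 2 * c, ?_, ?_⟩
    · ext <;> simp; ring
    · ext <;> simp <;> field_simp <;> ring

lemma nonempty_algEquiv_of_not_anisotropic (hchar : (2 : k) ≠ 0) (hc : c ≠ 0) (hd : d ≠ 0)
    (h : ¬PureAnisotropic c d) : Nonempty (ℍ[k, 1, 1] ≃ₐ[k] ℍ[k, c, d]) := by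
  simp only [PureAnisotropic, not_forall] at h
  obtain ⟨u, v, w, h0, hne⟩ := h
  obtain ⟨m, μ, hm, hnm⟩ := exists_hyperbolic_partner hchar hc hd hne
  set n : ℍ[k, c, d] := ⟨0, u, v, w⟩
  have hn : n * n = 0 := by
    rw [pureNorm] at h0
    ext <;> simp [n]
    · linear_combination h0
    all_goals ring
  obtain ⟨m', hm', hnm'⟩ : ∃ m', m' * m' = 0 ∧ n * m' + m' * n = 1 := by
    refine ⟨m - μ • n, ?_, ?_⟩
    · have h2 : (m - μ • n) * (m - μ • n) =
          m * m - μ • (n * m + m * n) + (μ * μ) • (n * n) := by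
        simp only [sub_mul, mul_sub, smul_mul_assoc, mul_smul_comm]
        module
      rw [h2, hm, hnm, hn]
      simp
    · have h2 : n * (m - μ • n) + (m - μ • n) * n =
          n * m + m * n - (2 * μ) • (n * n) := by
        simp only [sub_mul, mul_sub, smul_mul_assoc, mul_smul_comm]
        module
      rw [h2, hnm, hn]
      simp
  have e1 : n * m' = 1 - m' * n := eq_sub_of_add_eq hnm'
  have e2 : n * m' * n = n := by rw [e1, sub_mul, mul_assoc, hn]; simp
  have e3 : m' * n * m' = m' := by
    rw [mul_assoc, e1, mul_sub, ← mul_assoc, hm']; simp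
  have hpp : (n + m') * (n + m') = 1 := by
    simp only [add_mul, mul_add, hn, hm']
    rw [← hnm']
    abel
  have hrr : (m' * n - n * m') * (m' * n - n * m') = 1 := by
    have h1 : (m' * n - n * m') * (m' * n - n * m') =
        (m' * n * m') * n - m' * (n * n) * m' - n * (m' * m') * n + (n * m' * n) * m' := by
      noncomm_ring
    rw [h1, e2, e3, hn, hm', ← hnm']
    simp [add_comm]
  have hpr : (m' * n - n * m') * (n + m') = -((n + m') * (m' * n - n * m')) := by
    have h1 : (m' * n - n * m') * (n + m') + (n + m') * (m' * n - n * m') =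
        (n * n) * (-m') + (n * n) * m' + m' * (n * n) - (n * n) * m' + m' * m' * n
        - n * (m' * m') := by
      noncomm_ring
    rw [eq_neg_iff_add_eq_zero, h1, hn, hm']
    simp
  exact QuaternionAlgebra.Basis.nonempty_algEquiv_s4 hchar one_ne_zero one_ne_zero
    { i := n + m', j := m' * n - n * m', k := (n + m') * (m' * n - n * m'),
      i_mul_i := by simpa using hpp, j_mul_j := by simpa using hrr, i_mul_j := rfl,
      j_mul_i := by simpa using hpr }

end QuaternionBases

section WittTheorem

open Quaternion

variable {k : Type*} [Field k] {a b c d : k}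

lemma IsConicFunctionField.of_algEquiv (hchar : (2 : k) ≠ 0) (ha : a ≠ 0) (hb : b ≠ 0)
    (hc : c ≠ 0) (hd : d ≠ 0) {K : Type*} [Field K] [Algebra k K]
    (hK : IsConicFunctionField k a b K (algebraMap k K))
    (φ : ℍ[k, a, b] ≃ₐ[k] ℍ[k, c, d]) :
    IsConicFunctionField k c d K (algebraMap k K) := by
  obtain ⟨F, hF, -⟩ := hK.exists_algHom hb
  obtain ⟨m, hm⟩ := QuaternionAlgebra.Basis.exists_isometry hchar ha hb
    ((QuaternionAlgebra.Basis.self k).compHom φ.toAlgHom)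
  obtain ⟨x', y', h⟩ := hF.exists_of_isometry hchar ha hb hc hd m hm
  exact h.isConicFunctionField hchar hc hd

lemma PureAnisotropic.nonempty_algEquiv_s4 (h : PureAnisotropic c d) (hchar : (2 : k) ≠ 0)
    (ha : a ≠ 0) (hb : b ≠ 0) (hd : d ≠ 0) {K L : Type*} [Field K] [Field L]
    {ι : k →+* K} {ι' : k →+* L} (hK : IsConicFunctionField k a b K ι)
    (hL : IsConicFunctionField k c d L ι') (e : L ≃+* K) (he : ∀ r, e (ι' r) = ι r) :
    Nonempty (ℍ[k, a, b] ≃ₐ[k] ℍ[k, c, d]) := by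
  let := ι.toAlgebra
  let := ι'.toAlgebra
  obtain ⟨F, hF, -⟩ := IsConicFunctionField.exists_algHom (K := L) hd hL
  have hpt := congrArg e hF.conic
  simp only [map_add, map_mul, map_pow, map_one] at hpt
  obtain ⟨u, v, w, s, t, z, h1, h2, h3⟩ :=
    h.exists_orthogonal_of_point hchar ha hb (K := K) hK (X' := e (F _)) (Y' := e (F _)) (by
      rw [← hpt]
      exact congrArg₂ _ (congrArg (· * _) (he c).symm) (congrArg (· * _) (he d).symm))
  exact nonempty_algEquiv_of_orthogonal hchar ha hb h1 h2 h3

end WittTheorem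

open Quaternion in
/-- (E. Witt) Let `k` be a field of characteristic `≠ 2` and `a, b, c, d ∈ k` nonzero, and
let `K` and `L` be the function fields `k_{a,b}` and `k_{c,d}` respectively.  The
quaternion algebras `(a,b/k)` and `(c,d/k)` are `k`-isomorphic if and only if `k_{a,b}`
and `k_{c,d}` are `k`-isomorphic. -/
theorem quaternionAlgebra_iso_iff_conicFunctionField_iso
    (k : Type*) [Field k] (hchar : (2 : k) ≠ 0)
    (a b c d : k) (ha : a ≠ 0) (hb : b ≠ 0) (hc : c ≠ 0) (hd : d ≠ 0)
    (K : Type*) [Field K] (ι : k →+* K) (hK : IsConicFunctionField k a b K ι)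
    (L : Type*) [Field L] (ι' : k →+* L) (hL : IsConicFunctionField k c d L ι') :
    Nonempty (ℍ[k, a, b] ≃ₐ[k] ℍ[k, c, d]) ↔
      ∃ e : K ≃+* L, ∀ r : k, e (ι r) = ι' r := by
  constructor
  · rintro ⟨φ⟩
    let := ι.toAlgebra
    exact (IsConicFunctionField.of_algEquiv (K := K) hchar ha hb hc hd hK φ).exists_ringEquiv hL
  · rintro ⟨e, he⟩
    have he' : ∀ r, e.symm (ι' r) = ι r := fun r => by rw [← he, e.symm_apply_apply]
    by_cases hcd : PureAnisotropic c d
    · exact hcd.nonempty_algEquiv_s4 hchar ha hb hd hK hL e.symm he'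
    by_cases hab : PureAnisotropic a b
    · obtain ⟨φ⟩ := hab.nonempty_algEquiv_s4 hchar hc hd hb hL hK e he
      exact ⟨φ.symm⟩
    obtain ⟨φ⟩ := nonempty_algEquiv_of_not_anisotropic hchar ha hb hab
    obtain ⟨ψ⟩ := nonempty_algEquiv_of_not_anisotropic hchar hc hd hcd
    exact ⟨φ.symm.trans ψ⟩

end
end

section
/- Let k be a field of characteristic ≠ 2 and let a, b ∈ k be nonzero. An ordering P of k extends to an ordering of k_{a,b} if and only if at least one of a, b belongs to P (i.e., at least one of a, b is positive at the ordering). -/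
open MvPolynomial

noncomputable section

namespace IsOrdering

variable {F : Type*} [Field F] {P : Set F}

theorem zero_mem (hP : IsOrdering P) : (0 : F) ∈ P := by
  simpa using hP.total 0

theorem sq_mem (hP : IsOrdering P) (x : F) : x ^ 2 ∈ P := by
  rcases hP.total x with h | h
  · simpa [sq] using hP.mul_mem x h x h
  · simpa [sq] using hP.mul_mem _ h _ h

theorem one_mem (hP : IsOrdering P) : (1 : F) ∈ P := by
  simpa using hP.sq_mem 1

theorem inv_mem (hP : IsOrdering P) {x : F} (hx : x ∈ P) : x⁻¹ ∈ P := by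
  rcases eq_or_ne x 0 with rfl | h
  · simpa using hx
  · have := hP.mul_mem _ hx _ (hP.sq_mem x⁻¹)
    rwa [show x * x⁻¹ ^ 2 = x⁻¹ by field_simp] at this

end IsOrdering

/-- The preordering `T - x T`, for `x` outside the preordering `T` of a field. -/
def RingPreordering.adjoinNeg {F : Type*} [Field F] (T : RingPreordering F) (x : F) (hx : x ∉ T) :
    RingPreordering F where
  carrier := {z | ∃ s ∈ T, ∃ t ∈ T, z = s - x * t}
  zero_mem' := ⟨0, zero_mem T, 0, zero_mem T, by ring⟩
  one_mem' := ⟨1, one_mem T, 0, zero_mem T, by ring⟩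
  add_mem' := by
    rintro _ _ ⟨s, hs, t, ht, rfl⟩ ⟨s', hs', t', ht', rfl⟩
    exact ⟨s + s', add_mem hs hs', t + t', add_mem ht ht', by ring⟩
  mul_mem' := by
    rintro _ _ ⟨s, hs, t, ht, rfl⟩ ⟨s', hs', t', ht', rfl⟩
    exact ⟨s * s' + x ^ 2 * (t * t'),
      add_mem (mul_mem hs hs') (mul_mem (T.pow_two_mem x) (mul_mem ht ht')),
      s * t' + t * s', add_mem (mul_mem hs ht') (mul_mem ht hs'), by ring⟩
  mem_of_isSquare' := fun {z} hz => ⟨z, T.mem_of_isSquare hz, 0, zero_mem T, by ring⟩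
  neg_one_notMem' := by
    rintro ⟨s, hs, t, ht, h⟩
    have ht0 : t ≠ 0 := by
      rintro rfl
      exact T.neg_one_notMem (by rw [h]; simpa using hs)
    apply hx
    have hxt : x = (1 + s) * t * t⁻¹ ^ 2 := by
      field_simp
      linear_combination h
    rw [hxt]
    exact mul_mem (mul_mem (add_mem (one_mem T) hs) ht) (T.pow_two_mem _)

theorem RingPreordering.isOrdering_of_isMax {F : Type*} [Field F] {T : RingPreordering F}
    (hT : IsMax T) : _root_.IsOrdering (T : Set F) where
  add_mem _ hx _ hy := add_mem hx hy
  mul_mem _ hx _ hy := mul_mem hx hy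
  total x := by
    by_contra! h
    have hle : T ≤ T.adjoinNeg x h.1 := fun z hz => ⟨z, hz, 0, zero_mem T, by ring⟩
    exact h.2 (hT hle ⟨0, zero_mem T, 1, one_mem T, by ring⟩)
  antisymm x hx hnx := by
    by_contra h0
    apply T.neg_one_notMem
    rw [show (-1 : F) = x * -x * x⁻¹ ^ 2 by field_simp]
    exact mul_mem (mul_mem hx hnx) (T.pow_two_mem _)

theorem RingPreordering.exists_isOrdering {F : Type*} [Field F] (T : RingPreordering F) :
    ∃ Q : Set F, _root_.IsOrdering Q ∧ (T : Set F) ⊆ Q := by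
  obtain ⟨M, hTM, hM⟩ := zorn_le_nonempty_Ici₀ T (fun c _ hc S hS => by
    have hdir : DirectedOn (· ≤ ·) c := hc.directedOn
    refine ⟨{
      carrier := ⋃ U ∈ c, (U : Set F)
      zero_mem' := Set.mem_biUnion hS (zero_mem S)
      one_mem' := Set.mem_biUnion hS (one_mem S)
      add_mem' := ?_
      mul_mem' := ?_
      mem_of_isSquare' := fun hx => Set.mem_biUnion hS (S.mem_of_isSquare hx)
      neg_one_notMem' := ?_ }, ?_⟩
    · intro x y hx hy
      simp only [Set.mem_iUnion, exists_prop] at hx hy ⊢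
      obtain ⟨U, hU, hx⟩ := hx
      obtain ⟨V, hV, hy⟩ := hy
      obtain ⟨W, hW, hUW, hVW⟩ := hdir U hU V hV
      exact ⟨W, hW, mul_mem (hUW hx) (hVW hy)⟩
    · intro x y hx hy
      simp only [Set.mem_iUnion, exists_prop] at hx hy ⊢
      obtain ⟨U, hU, hx⟩ := hx
      obtain ⟨V, hV, hy⟩ := hy
      obtain ⟨W, hW, hUW, hVW⟩ := hdir U hU V hV
      exact ⟨W, hW, add_mem (hUW hx) (hVW hy)⟩
    · intro h
      simp only [Set.mem_iUnion, exists_prop] at h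
      obtain ⟨U, -, hU⟩ := h
      exact U.neg_one_notMem hU
    · exact fun U hU x hx => Set.mem_biUnion hU hx) T le_rfl
  exact ⟨M, isOrdering_of_isMax hM, hTM⟩

/-- An ordering `P` extends along `ι` as soon as `-1` is not a sum of elements `ι p * z ^ 2`
with `p ∈ P`. -/
theorem IsOrdering.exists_extension {k K : Type*} [Field k] [Field K] {P : Set k}
    (hP : IsOrdering P) (ι : k →+* K)
    (h : (-1 : K) ∉ AddSubmonoid.closure {z : K | ∃ p ∈ P, ∃ w : K, z = ι p * w ^ 2}) :
    ∃ Q : Set K, IsOrdering Q ∧ ι ⁻¹' Q = P := by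
  let M : Submonoid K :=
    { carrier := {z : K | ∃ p ∈ P, ∃ w : K, z = ι p * w ^ 2}
      one_mem' := ⟨1, hP.one_mem, 1, by simp⟩
      mul_mem' := by
        rintro _ _ ⟨p, hp, w, rfl⟩ ⟨q, hq, v, rfl⟩
        exact ⟨p * q, hP.mul_mem p hp q hq, w * v, by rw [map_mul]; ring⟩ }
  let T : RingPreordering K :=
    { M.subsemiringClosure with
      mem_of_isSquare' := by
        rintro _ ⟨w, rfl⟩
        exact AddSubmonoid.subset_closure ⟨1, hP.one_mem, w, by rw [map_one]; ring⟩
      neg_one_notMem' := h }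
  obtain ⟨Q, hQ, hTQ⟩ := T.exists_isOrdering
  have hPQ : ∀ p ∈ P, ι p ∈ Q := fun p hp =>
    hTQ (AddSubmonoid.subset_closure ⟨p, hp, 1, by ring⟩)
  refine ⟨Q, hQ, Set.Subset.antisymm (fun c hc => ?_) hPQ⟩
  rcases hP.total c with h' | h'
  · exact h'
  · have h0 : ι c = 0 := hQ.antisymm _ hc (by simpa using hPQ _ h')
    rw [(map_eq_zero ι).1 h0]
    exact hP.zero_mem

theorem Polynomial.trailingCoeff_eq_coeff {R : Type*} [Semiring R] {h : Polynomial R} {m : ℕ}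
    (hlt : ∀ i < m, h.coeff i = 0) (hm : h.coeff m ≠ 0) : h.trailingCoeff = h.coeff m := by
  rw [trailingCoeff, le_antisymm (natTrailingDegree_le_of_ne_zero hm)]
  exact le_natTrailingDegree (fun h0 => hm (by simp [h0])) hlt

namespace IsOrdering

variable {k : Type*} [Field k] {P : Set k}

theorem trailingCoeff_add_mem (hP : IsOrdering P) {p q : Polynomial k}
    (hp : p.trailingCoeff ∈ P) (hq : q.trailingCoeff ∈ P) : (p + q).trailingCoeff ∈ P := by
  rcases eq_or_ne p 0 with rfl | hp0
  · simpa using hq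
  rcases eq_or_ne q 0 with rfl | hq0
  · simpa using hp
  wlog hle : p.natTrailingDegree ≤ q.natTrailingDegree generalizing p q
  · rw [add_comm]
    exact this hq hp hq0 hp0 (le_of_not_ge hle)
  have hqc : q.coeff p.natTrailingDegree ∈ P := by
    rcases hle.lt_or_eq with hlt | heq
    · rw [Polynomial.coeff_eq_zero_of_lt_natTrailingDegree hlt]
      exact hP.zero_mem
    · rwa [heq]
  have hsum : (p + q).coeff p.natTrailingDegree ∈ P := by
    rw [Polynomial.coeff_add]
    exact hP.add_mem _ hp _ hqc
  rwa [Polynomial.trailingCoeff_eq_coeff (m := p.natTrailingDegree)]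
  · intro i hi
    rw [Polynomial.coeff_add, Polynomial.coeff_eq_zero_of_lt_natTrailingDegree hi,
      Polynomial.coeff_eq_zero_of_lt_natTrailingDegree (hi.trans_le hle), add_zero]
  · intro h0
    rw [Polynomial.coeff_add] at h0
    refine hp0 (Polynomial.trailingCoeff_eq_zero.1 (hP.antisymm _ hp ?_))
    rwa [show -p.trailingCoeff = q.coeff p.natTrailingDegree from
      (eq_neg_of_add_eq_zero_right h0).symm]

theorem eq_zero_of_trailingCoeff_mem (hP : IsOrdering P) {p q : Polynomial k}
    (hp : p.trailingCoeff ∈ P) (hq : q.trailingCoeff ∈ P) (h : p + q = 0) : p = 0 := by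
  refine Polynomial.trailingCoeff_eq_zero.1 (hP.antisymm _ hp ?_)
  rw [eq_neg_of_add_eq_zero_left h] at hp ⊢
  convert hq using 1
  simp [Polynomial.trailingCoeff]

theorem trailingCoeff_mul_mem (hP : IsOrdering P) {p q : Polynomial k}
    (hp : p.trailingCoeff ∈ P) (hq : q.trailingCoeff ∈ P) : (p * q).trailingCoeff ∈ P := by
  rw [Polynomial.trailingCoeff_mul]
  exact hP.mul_mem _ hp _ hq

theorem trailingCoeff_sq_mem (hP : IsOrdering P) (p : Polynomial k) :
    (p ^ 2).trailingCoeff ∈ P := by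
  rw [sq, Polynomial.trailingCoeff_mul, ← sq]
  exact hP.sq_mem _

end IsOrdering

/-- The value `(1 - b y²) / a` of `x²` on the conic `a x² + b y² = 1`. -/
def conicRadicand {k : Type*} [Field k] (a b : k) : Polynomial k :=
  Polynomial.C a⁻¹ * (1 - Polynomial.C b * Polynomial.X ^ 2)

theorem trailingCoeff_conicRadicand {k : Type*} [Field k] {a : k} (ha : a ≠ 0) (b : k) :
    (conicRadicand a b).trailingCoeff = a⁻¹ := by
  have h : (conicRadicand a b).coeff 0 = a⁻¹ := by simp [conicRadicand]
  rw [Polynomial.trailingCoeff_eq_coeff_zero (by rw [h]; exact inv_ne_zero ha), h]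

namespace ConicRing

variable {k : Type*} [Field k] {a b : k}

theorem relation (a b : k) :
    algebraMap k (ConicRing k a b) a * Ideal.Quotient.mk _ (X 0) ^ 2 +
      algebraMap k (ConicRing k a b) b * Ideal.Quotient.mk _ (X 1) ^ 2 = 1 := by
  have h : Ideal.Quotient.mk (Ideal.span {conicPoly k a b})
      (C a * X 0 ^ 2 + C b * X 1 ^ 2 - 1) = 0 :=
    Ideal.Quotient.eq_zero_iff_mem.2 (Ideal.mem_span_singleton_self _)
  rw [map_sub, map_add, map_mul, map_mul, map_pow, map_pow, map_one, sub_eq_zero] at h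
  exact h

/-- The coordinate ring of the conic `a x² + b y² = 1` maps to `k[y][ω]` with
`ω² = (1 - b y²) / a`, by `x ↦ ω`. -/
def toQuadratic (ha : a ≠ 0) (b : k) :
    ConicRing k a b →ₐ[k] QuadraticAlgebra (Polynomial k) (conicRadicand a b) 0 :=
  Ideal.Quotient.liftₐ _ (aeval ![⟨0, 1⟩, ⟨Polynomial.X, 0⟩]) (fun g hg => by
    obtain ⟨c, rfl⟩ := Ideal.mem_span_singleton.1 hg
    rw [map_mul]
    convert zero_mul _
    have hC : Polynomial.C a * Polynomial.C a⁻¹ = 1 := by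
      rw [← Polynomial.C_mul, mul_inv_cancel₀ ha, Polynomial.C_1]
    have halg (c : k) : algebraMap k (QuadraticAlgebra (Polynomial k) (conicRadicand a b) 0) c =
        ⟨Polynomial.C c, 0⟩ := rfl
    ext1
    · simp only [conicPoly, sq, map_sub, map_add, map_mul, map_one, aeval_X, algHom_C, halg]
      simp only [QuadraticAlgebra.re_sub, QuadraticAlgebra.re_add, QuadraticAlgebra.re_mul,
        QuadraticAlgebra.im_mul, QuadraticAlgebra.re_one, QuadraticAlgebra.re_zero,
        Matrix.cons_val_zero, Matrix.cons_val_one]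
      rw [conicRadicand]
      linear_combination (1 - Polynomial.C b * Polynomial.X ^ 2) * hC
    · simp only [conicPoly, sq, map_sub, map_add, map_mul, map_one, aeval_X, algHom_C, halg]
      simp [QuadraticAlgebra.im_one])

theorem toQuadratic_mk (ha : a ≠ 0) (b : k) (g : MvPolynomial (Fin 2) k) :
    toQuadratic ha b (Ideal.Quotient.mk _ g) = aeval ![⟨0, 1⟩, ⟨Polynomial.X, 0⟩] g :=
  rfl

theorem toQuadratic_injective (ha : a ≠ 0) (b : k) :
    Function.Injective (toQuadratic ha b) := by
  let x : ConicRing k a b := Ideal.Quotient.mk _ (X 0)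
  let y : ConicRing k a b := Ideal.Quotient.mk _ (X 1)
  let θ (q : QuadraticAlgebra (Polynomial k) (conicRadicand a b) 0) : ConicRing k a b :=
    Polynomial.aeval y q.re + x * Polynomial.aeval y q.im
  have hx : x ^ 2 = Polynomial.aeval y (conicRadicand a b) := by
    have h := relation a b
    have ha' : algebraMap k (ConicRing k a b) a⁻¹ * algebraMap k _ a = 1 := by
      rw [← map_mul, inv_mul_cancel₀ ha, map_one]
    simp only [conicRadicand, map_mul, map_sub, map_one, map_pow, Polynomial.aeval_C,
      Polynomial.aeval_X]
    linear_combination algebraMap k (ConicRing k a b) a⁻¹ * h - x ^ 2 * ha'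
  refine Function.LeftInverse.injective (g := θ) fun g => ?_
  obtain ⟨g, rfl⟩ := Ideal.Quotient.mk_surjective g
  induction g using MvPolynomial.induction_on with
  | C c =>
    have h : toQuadratic ha b (Ideal.Quotient.mk _ (C c)) = ⟨Polynomial.C c, 0⟩ :=
      (toQuadratic ha b).commutes c
    simp only [θ, h, Polynomial.aeval_C, map_zero, mul_zero, add_zero]
    rfl
  | add p q hp hq =>
    rw [map_add, map_add]
    nth_rw 2 [← hp, ← hq]
    simp only [θ, QuadraticAlgebra.re_add, QuadraticAlgebra.im_add, map_add]
    ring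
  | mul_X p i hp =>
    rw [map_mul, map_mul]
    nth_rw 2 [← hp]
    fin_cases i
    · have h : toQuadratic ha b (Ideal.Quotient.mk _ (X 0)) = ⟨0, 1⟩ := by
        simp [toQuadratic_mk]
      simp only [Fin.zero_eta, h, θ, QuadraticAlgebra.re_mul, QuadraticAlgebra.im_mul, map_add,
        map_mul, map_zero, map_one, ← hx]
      ring
    · have h : toQuadratic ha b (Ideal.Quotient.mk _ (X 1)) = ⟨Polynomial.X, 0⟩ := by
        simp [toQuadratic_mk]
      simp only [Fin.mk_one, h, θ, QuadraticAlgebra.re_mul, QuadraticAlgebra.im_mul, map_add,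
        map_mul, map_zero, Polynomial.aeval_X]
      ring

theorem re_toQuadratic_algebraMap_mul_sq (ha : a ≠ 0) (b p : k) (g : ConicRing k a b) :
    (toQuadratic ha b (algebraMap k _ p * g ^ 2)).re =
      Polynomial.C p * ((toQuadratic ha b g).re ^ 2 +
        conicRadicand a b * (toQuadratic ha b g).im ^ 2) := by
  rw [map_mul, AlgHom.commutes, ← Algebra.smul_def, map_pow]
  simp [sq, Polynomial.smul_eq_C_mul]
  ring

end ConicRing

namespace IsOrdering

variable {k : Type*} [Field k] {P : Set k} {a b : k}

theorem trailingCoeff_toQuadratic_mem (hP : IsOrdering P) (ha : a ≠ 0) (b : k) (haP : a ∈ P)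
    {p : k} (hp : p ∈ P) (g : ConicRing k a b) :
    (ConicRing.toQuadratic ha b (algebraMap k _ p * g ^ 2)).re.trailingCoeff ∈ P := by
  rw [ConicRing.re_toQuadratic_algebraMap_mul_sq]
  refine hP.trailingCoeff_mul_mem ?_ (hP.trailingCoeff_add_mem (hP.trailingCoeff_sq_mem _)
    (hP.trailingCoeff_mul_mem ?_ (hP.trailingCoeff_sq_mem _)))
  · simpa [Polynomial.trailingCoeff] using hp
  · rw [trailingCoeff_conicRadicand ha]
    exact hP.inv_mem haP

theorem eq_zero_of_re_toQuadratic_sq (hP : IsOrdering P) (ha : a ≠ 0) (haP : a ∈ P)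
    {g : ConicRing k a b} (hg : (ConicRing.toQuadratic ha b (g ^ 2)).re = 0) : g = 0 := by
  have h := ConicRing.re_toQuadratic_algebraMap_mul_sq ha b 1 g
  rw [map_one, one_mul, hg, Polynomial.C_1, one_mul] at h
  have hα := trailingCoeff_conicRadicand ha b
  have hre := hP.eq_zero_of_trailingCoeff_mem (hP.trailingCoeff_sq_mem _)
    (hP.trailingCoeff_mul_mem (hα ▸ hP.inv_mem haP) (hP.trailingCoeff_sq_mem _)) h.symm
  rw [hre, zero_add, eq_comm, mul_eq_zero] at h
  have hα0 : conicRadicand a b ≠ 0 := by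
    rw [← Polynomial.trailingCoeff_nonzero_iff_nonzero, hα]
    exact inv_ne_zero ha
  apply ConicRing.toQuadratic_injective ha b
  rw [map_zero]
  ext1
  · exact pow_eq_zero_iff two_ne_zero |>.1 hre
  · exact pow_eq_zero_iff two_ne_zero |>.1 (h.resolve_left hα0)

theorem exists_extension_conicFunctionField (hP : IsOrdering P) (ha : a ≠ 0) (haP : a ∈ P)
    {K : Type*} [Field K] {ι : k →+* K} (hK : IsConicFunctionField k a b K ι) :
    ∃ Q : Set K, IsOrdering Q ∧ ι ⁻¹' Q = P := by
  obtain ⟨f, hf, rfl, hfrac⟩ := hK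
  refine hP.exists_extension _ fun hneg => ?_
  have key : ∀ z ∈ AddSubmonoid.closure {z : K | ∃ p ∈ P, ∃ w : K,
      z = (f.comp (algebraMap k (ConicRing k a b))) p * w ^ 2},
      ∃ d w : ConicRing k a b, f d ≠ 0 ∧ f w = z * f d ^ 2 ∧
        ∀ e, (ConicRing.toQuadratic ha b (e ^ 2 * w)).re.trailingCoeff ∈ P := by
    intro z hz
    induction hz using AddSubmonoid.closure_induction with
    | mem z hz =>
      obtain ⟨p, hp, w, rfl⟩ := hz
      obtain ⟨g, q, hq, rfl⟩ := hfrac w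
      refine ⟨q, algebraMap k _ p * g ^ 2, hq, ?_, fun e => ?_⟩
      · simp only [map_mul, map_pow, RingHom.comp_apply]
        field_simp
      · rw [show e ^ 2 * (algebraMap k _ p * g ^ 2) = algebraMap k _ p * (e * g) ^ 2 by ring]
        exact hP.trailingCoeff_toQuadratic_mem ha b haP hp _
    | zero => exact ⟨1, 0, by simp, by simp, fun e => by simpa using hP.zero_mem⟩
    | add z₁ z₂ _ _ h₁ h₂ =>
      obtain ⟨d₁, w₁, hd₁, hw₁, h₁⟩ := h₁
      obtain ⟨d₂, w₂, hd₂, hw₂, h₂⟩ := h₂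
      refine ⟨d₁ * d₂, d₂ ^ 2 * w₁ + d₁ ^ 2 * w₂, by simp [hd₁, hd₂], ?_, fun e => ?_⟩
      · simp only [map_add, map_mul, map_pow, hw₁, hw₂]
        ring
      · rw [show e ^ 2 * (d₂ ^ 2 * w₁ + d₁ ^ 2 * w₂) =
          (e * d₂) ^ 2 * w₁ + (e * d₁) ^ 2 * w₂ by ring, map_add]
        exact hP.trailingCoeff_add_mem (h₁ _) (h₂ _)
  obtain ⟨d, w, hd, hw, h⟩ := key _ hneg
  have hwd : w = -d ^ 2 := hf (by rw [hw]; simp)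
  have hw' := h 1
  have hd' := hP.trailingCoeff_toQuadratic_mem ha b haP hP.one_mem d
  rw [map_one, one_mul] at hd'
  rw [one_pow, one_mul] at hw'
  refine hd ?_
  rw [hP.eq_zero_of_re_toQuadratic_sq ha haP
    (hP.eq_zero_of_trailingCoeff_mem hd' hw' (by simp [hwd])), map_zero]

end IsOrdering

theorem IsConicFunctionField.swap {k : Type*} [Field k] {a b : k} {K : Type*} [Field K]
    {ι : k →+* K} (hK : IsConicFunctionField k a b K ι) : IsConicFunctionField k b a K ι := by
  obtain ⟨f, hf, rfl, hfrac⟩ := hK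
  let e : ConicRing k b a ≃ₐ[k] ConicRing k a b :=
    Ideal.quotientEquivAlg _ _ (renameEquiv k (Equiv.swap 0 1)) (by
      rw [Ideal.map_span, Set.image_singleton]
      congr 2
      simp [conicPoly, add_comm])
  refine ⟨f.comp (e : ConicRing k b a →+* ConicRing k a b), hf.comp e.injective, ?_, fun z => ?_⟩
  · ext c
    simp
  · obtain ⟨p, q, hq, rfl⟩ := hfrac z
    exact ⟨e.symm p, e.symm q, by simpa using hq, by simp⟩

theorem IsOrdering.pos_of_extension_conicFunctionField {k : Type*} [Field k] {a b : k}
    {K : Type*} [Field K] {ι : k →+* K} (hK : IsConicFunctionField k a b K ι) {Q : Set K}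
    (hQ : IsOrdering Q) : ι a ∈ Q ∨ ι b ∈ Q := by
  obtain ⟨f, -, rfl, -⟩ := hK
  by_contra! h
  have hna := (hQ.total _).resolve_left h.1
  have hnb := (hQ.total _).resolve_left h.2
  have hrel := congrArg f (ConicRing.relation a b)
  rw [map_add, map_mul, map_mul, map_pow, map_pow, map_one] at hrel
  refine one_ne_zero (hQ.antisymm 1 hQ.one_mem ?_)
  rw [← hrel]
  convert hQ.add_mem _ (hQ.mul_mem _ hna _ (hQ.sq_mem (f (Ideal.Quotient.mk _ (X 0))))) _
    (hQ.mul_mem _ hnb _ (hQ.sq_mem (f (Ideal.Quotient.mk _ (X 1))))) using 1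
  simp only [RingHom.comp_apply]
  ring

/-- Let `k` be a field of characteristic `≠ 2`, `a, b ∈ k` nonzero, and let `K` be the
function field `k_{a,b}` with embedding `ι : k →+* K`.  An ordering `P` of `k` extends to
an ordering of `k_{a,b}` if and only if at least one of `a, b` is positive at `P`. -/
theorem ordering_extends_to_conicFunctionField_iff
    (k : Type*) [Field k] (hchar : (2 : k) ≠ 0)
    (a b : k) (ha : a ≠ 0) (hb : b ≠ 0)
    (K : Type*) [Field K] (ι : k →+* K)
    (hK : IsConicFunctionField k a b K ι)
    (P : Set k) (hP : IsOrdering P) :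
    (∃ Q : Set K, IsOrdering Q ∧ ι ⁻¹' Q = P) ↔ (a ∈ P ∨ b ∈ P) := by
  constructor
  · rintro ⟨Q, hQ, rfl⟩
    exact hQ.pos_of_extension_conicFunctionField hK
  · rintro (h | h)
    · exact hP.exists_extension_conicFunctionField ha h hK
    · exact hP.exists_extension_conicFunctionField hb h hK.swap

end
end
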